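/- arXiv:1107.4754 — 2 statements merged into one kernel-verified Lean document; each statement's English description precedes it below -/
import Mathlib

section
/- Let ρ > 0, Δ > 1 and u > 0. Then the inverse Mellin-type integral H(u) = (1/2πi) ∫_{Δ−i∞}^{Δ+i∞} u^{−s} Γ(s+ρ) ζ(s+ρ+1) (1/s) ds (taken over the vertical line Re(s) = Δ) equals −∫_{u}^{∞} y^{ρ−1} log(1 − e^{−y}) dy, where Γ is the Gamma function and ζ the Riemann zeta function. -/
open Filter Topology Asymptotics MeasureTheory Real

noncomputable section

/-- `F_b(x) = -∑_{k≥1} b_k log(1 - x^k)` (so that `f_b = exp F_b`). -/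
def Fb (b : ℕ → ℝ) (x : ℝ) : ℝ := -∑' k : ℕ, b (k + 1) * Real.log (1 - x ^ (k + 1))

/-- Complex version of `log f_b` (principal branch). -/
def FbC (b : ℕ → ℝ) (x : ℂ) : ℂ := -∑' k : ℕ, (b (k + 1) : ℂ) * Complex.log (1 - x ^ (k + 1))

/-- `f_b(x) = ∏_{k≥1} (1 - x^k)^{-b_k}`. -/
def fb (b : ℕ → ℝ) (x : ℝ) : ℝ := Real.exp (Fb b x)

/-- Complex version of `f_b`. -/
def fbC (b : ℕ → ℝ) (x : ℂ) : ℂ := Complex.exp (FbC b x)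

/-- `F_{m,b}(x) = -∑_{k=1}^m b_k log(1 - x^k)`. -/
def Fmb (b : ℕ → ℝ) (m : ℕ) (x : ℝ) : ℝ := -∑ k ∈ Finset.Icc 1 m, b k * Real.log (1 - x ^ k)

/-- `f_{m,b}(x) = ∏_{k=1}^m (1 - x^k)^{-b_k}`. -/
def fmb (b : ℕ → ℝ) (m : ℕ) (x : ℝ) : ℝ := Real.exp (Fmb b m x)

/-- `𝒜_b(r) = r F_b'(r)`. -/
def Abf (b : ℕ → ℝ) (r : ℝ) : ℝ := r * deriv (Fb b) r

/-- `ℬ_b(r) = r² F_b''(r) + r F_b'(r)`. -/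
def Bbf (b : ℕ → ℝ) (r : ℝ) : ℝ :=
  r ^ 2 * iteratedDeriv 2 (Fb b) r + r * deriv (Fb b) r

/-- Meinardus condition (M1): the Dirichlet series `D(s) = ∑_{k≥1} b_k k^{-s}` converges for
`Re s > ρ` and `Dc` is its analytic continuation to `{Re s ≥ -C₀}`, analytic there except for a
simple pole at `s = ρ` with residue `A > 0`. -/
def M1 (b : ℕ → ℝ) (ρ C₀ A : ℝ) (Dc : ℂ → ℂ) : Prop :=
  0 < ρ ∧ 0 < C₀ ∧ C₀ < 1 ∧ 0 < A ∧
  (∀ s : ℂ, ρ < s.re →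
    HasSum (fun k : ℕ => (b (k + 1) : ℂ) * ((k + 1 : ℕ) : ℂ) ^ (-s)) (Dc s)) ∧
  (∀ s : ℂ, -C₀ ≤ s.re → s ≠ (ρ : ℂ) → DifferentiableAt ℂ Dc s) ∧
  (∃ φ : ℂ → ℂ, (∀ s : ℂ, -C₀ ≤ s.re → DifferentiableAt ℂ φ s) ∧
    ∀ s : ℂ, -C₀ ≤ s.re → s ≠ (ρ : ℂ) → Dc s = (A : ℂ) / (s - (ρ : ℂ)) + φ s)

/-- Meinardus condition (M2): the continuation `Dc` is of finite order `C₁` in `{Re s ≥ -C₀}`,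
i.e. `Dc s = O(|Im s|^{C₁})` as `|Im s| → ∞`, uniformly in `Re s ≥ -C₀`. -/
def M2 (C₀ C₁ : ℝ) (Dc : ℂ → ℂ) : Prop :=
  0 < C₁ ∧ ∃ K y₀ : ℝ, ∀ s : ℂ, -C₀ ≤ s.re → y₀ ≤ |s.im| → ‖Dc s‖ ≤ K * |s.im| ^ C₁

/-- Meinardus condition (M3): `∑_{k≥1} b_k e^{-kα} sin²(πku) ≥ C₂ α^{-ε}` for all small `α > 0`
and all `u` with `α/(2π) < |u| ≤ 1/2`. -/
def M3 (b : ℕ → ℝ) : Prop :=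
  ∃ ε C₂ : ℝ, 0 < ε ∧ 0 < C₂ ∧ ∃ α₀ : ℝ, 0 < α₀ ∧ ∀ α : ℝ, 0 < α → α ≤ α₀ →
    ∀ u : ℝ, α / (2 * π) < |u| → |u| ≤ 1 / 2 →
      C₂ * α ^ (-ε) ≤
        ∑' k : ℕ, b (k + 1) * Real.exp (-((k : ℝ) + 1) * α) * Real.sin (π * ((k : ℝ) + 1) * u) ^ 2

/-- `h = A Γ(ρ+1) ζ(ρ+1)`. -/
def hMein (ρ A : ℝ) : ℝ := A * Real.Gamma (ρ + 1) * (riemannZeta ((ρ : ℂ) + 1)).re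

/-- The normalizing constant `a(n) = (A Γ(ρ+1) ζ(ρ+1) / n)^{1/(ρ+1)}`. -/
def aM (ρ A : ℝ) (n : ℕ) : ℝ := (hMein ρ A / n) ^ ((1 : ℝ) / (ρ + 1))

/-- The function `-log(1 - e^{-y})`, complex valued. -/
def Lc16 (y : ℝ) : ℂ := ((-Real.log (1 - Real.exp (-y)) : ℝ) : ℂ)

lemma mellin_Lc16 {s : ℂ} (hs : 0 < s.re) :
    mellin Lc16 s = Complex.Gamma s * riemannZeta (s + 1) := by
  have h := hasSum_mellin (ι := ℕ) (a := fun n => 1 / ((n : ℂ) + 1)) (p := fun n => (n : ℝ) + 1)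
    (F := Lc16) (s := s) (fun i => Or.inr (by positivity)) hs ?_ ?_
  · rw [← h.tsum_eq, zeta_eq_tsum_one_div_nat_add_one_cpow (by simpa using hs), ← tsum_mul_left]
    congr 1
    ext n
    have hn : (n : ℂ) + 1 ≠ 0 := by exact_mod_cast Nat.succ_ne_zero n
    push_cast
    rw [Complex.cpow_add _ _ hn, Complex.cpow_one]
    field_simp
  · intro t ht
    have ht : 0 < t := ht
    have h1 : |Real.exp (-t)| < 1 := by
      rw [abs_of_pos (Real.exp_pos _)]; simpa using ht
    have h2 := Complex.hasSum_ofReal.mpr (Real.hasSum_pow_div_log_of_abs_lt_one h1)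
    change HasSum _ (((-Real.log (1 - Real.exp (-t)) : ℝ) : ℂ))
    convert h2 using 2 with n
    rw [← Real.exp_nat_mul]
    push_cast
    rw [show ((n : ℂ) + 1) * -(t : ℂ) = -((n : ℂ) + 1) * t by ring]
    ring
  · have : Summable fun n : ℕ => 1 / ((n + 1 : ℕ) : ℝ) ^ (s.re + 1) :=
      (summable_nat_add_iff 1).mpr (Real.summable_one_div_nat_rpow.mpr (by linarith))
    refine this.congr fun n => ?_
    have hn : (0 : ℝ) < (n : ℝ) + 1 := by positivity
    have e : ‖1 / ((n : ℂ) + 1)‖ = 1 / ((n : ℝ) + 1) := by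
      rw [norm_div, norm_one]
      congr 1
      have := Complex.norm_natCast (n + 1)
      push_cast at this
      exact this
    rw [e]
    push_cast
    rw [Real.rpow_add hn, Real.rpow_one]
    field_simp

lemma mellinConvergent_Lc16 {s : ℂ} (hs : 0 < s.re) : MellinConvergent Lc16 s := by
  refine Integrable.of_integral_ne_zero ?_
  change mellin Lc16 s ≠ 0
  rw [mellin_Lc16 hs]
  exact mul_ne_zero (Complex.Gamma_ne_zero_of_re_pos hs)
    (riemannZeta_ne_zero_of_one_le_re (by simpa using hs.le))

lemma mellin_tail16 {g : ℝ → ℂ} (hg : Measurable g) {s : ℂ} (hs : 0 < s.re)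
    (hc : MellinConvergent g (s + 1)) :
    MellinConvergent (fun u => ∫ y in Set.Ioi u, g y) s ∧
      mellin (fun u => ∫ y in Set.Ioi u, g y) s = mellin g (s + 1) / s := by
  have hs0 : s ≠ 0 := by rintro rfl; simp at hs
  let μ : Measure ℝ := volume.restrict (Set.Ioi 0)
  let F : ℝ → ℝ → ℂ := fun u y => if u < y then (u : ℂ) ^ (s - 1) * g y else 0
  have hFm : Measurable (Function.uncurry F) := by
    refine Measurable.ite (measurableSet_lt measurable_fst measurable_snd) ?_ measurable_const
    fun_prop
  have hF1 : ∀ u ∈ Set.Ioi (0 : ℝ), ∫ y, F u y ∂μ = (u : ℂ) ^ (s - 1) • ∫ y in Set.Ioi u, g y := by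
    intro u hu
    have hu : 0 < u := hu
    have e : F u = (Set.Ioi u).indicator (fun y => (u : ℂ) ^ (s - 1) * g y) := by
      ext y; simp [F, Set.indicator_apply]
    rw [e, integral_indicator measurableSet_Ioi, Measure.restrict_restrict measurableSet_Ioi,
      Set.inter_eq_left.mpr (Set.Ioi_subset_Ioi hu.le), integral_const_mul, smul_eq_mul]
  have hFy : ∀ y, (fun u => F u y) = (Set.Iio y).indicator (fun u : ℝ => (u : ℂ) ^ (s - 1) * g y) := by
    intro y; ext u; simp [F, Set.indicator_apply]
  have hinter : ∀ y : ℝ, Set.Iio y ∩ Set.Ioi 0 = Set.Ioo 0 y := by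
    intro y; ext; simp [and_comm]
  have hre : -1 < (s - 1).re := by simp; linarith
  have hF2 : ∀ y ∈ Set.Ioi (0 : ℝ), ∫ u, F u y ∂μ = ((y : ℂ) ^ (s + 1 - 1) • g y) / s := by
    intro y hy
    have hy : 0 < y := hy
    rw [hFy, integral_indicator measurableSet_Iio, Measure.restrict_restrict measurableSet_Iio,
      hinter, ← integral_Ioc_eq_integral_Ioo, ← intervalIntegral.integral_of_le hy.le,
      intervalIntegral.integral_mul_const, integral_cpow (Or.inl hre)]
    simp [hs0]
    ring
  have hF3 : ∀ y ∈ Set.Ioi (0 : ℝ), ∫ u, ‖F u y‖ ∂μ = ‖(y : ℂ) ^ (s + 1 - 1) • g y‖ / s.re := by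
    intro y hy
    have hy : 0 < y := hy
    have e : (fun u => ‖F u y‖) = (Set.Iio y).indicator (fun u : ℝ => ‖(u : ℂ) ^ (s - 1) * g y‖) := by
      ext u; simp [F, Set.indicator_apply]; split_ifs <;> simp
    rw [e, integral_indicator measurableSet_Iio, Measure.restrict_restrict measurableSet_Iio,
      hinter]
    have e2 : ∫ u in Set.Ioo 0 y, ‖(u : ℂ) ^ (s - 1) * g y‖ =
        ∫ u in Set.Ioo 0 y, u ^ (s.re - 1) * ‖g y‖ := by
      refine setIntegral_congr_fun measurableSet_Ioo fun u hu => ?_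
      simp only [norm_mul]
      rw [Complex.norm_cpow_eq_rpow_re_of_pos hu.1]
      simp
    rw [e2, ← integral_Ioc_eq_integral_Ioo, ← intervalIntegral.integral_of_le hy.le,
      intervalIntegral.integral_mul_const, integral_rpow (Or.inl (by linarith)), norm_smul,
      Complex.norm_cpow_eq_rpow_re_of_pos hy]
    simp [Real.zero_rpow hs.ne']
    ring
  have hI : Integrable (Function.uncurry F) (μ.prod μ) := by
    rw [integrable_prod_iff' hFm.aestronglyMeasurable]
    constructor
    · refine (ae_restrict_iff' measurableSet_Ioi).mpr (Eventually.of_forall fun y hy => ?_)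
      have hy : 0 < y := hy
      change Integrable (fun u => F u y) μ
      rw [hFy, integrable_indicator_iff measurableSet_Iio, IntegrableOn,
        Measure.restrict_restrict measurableSet_Iio, hinter]
      refine Integrable.mul_const ?_ _
      have := (intervalIntegral.intervalIntegrable_cpow' (a := 0) (b := y) hre)
      rw [intervalIntegrable_iff_integrableOn_Ioo_of_le hy.le] at this
      exact this
    · have h1 : Integrable (fun y : ℝ => ‖(y : ℂ) ^ (s + 1 - 1) • g y‖ / s.re) μ :=
        (Integrable.norm hc).div_const _
      refine h1.congr ?_
      refine (ae_restrict_iff' measurableSet_Ioi).mpr (Eventually.of_forall fun y hy => ?_)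
      exact (hF3 y hy).symm
  constructor
  · refine hI.integral_prod_left.congr ?_
    exact (ae_restrict_iff' measurableSet_Ioi).mpr (Eventually.of_forall fun u hu => hF1 u hu)
  · have := integral_integral_swap hI
    rw [mellin, ← setIntegral_congr_fun measurableSet_Ioi hF1, this,
      setIntegral_congr_fun measurableSet_Ioi hF2, integral_div, mellin]

lemma norm_Gamma_le16 {w : ℂ} (hw : 0 < w.re) : ‖Complex.Gamma w‖ ≤ Real.Gamma w.re := by
  rw [Complex.Gamma_eq_integral hw, Complex.GammaIntegral, Real.Gamma_eq_integral hw]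
  refine (norm_integral_le_integral_norm _).trans (le_of_eq ?_)
  refine setIntegral_congr_fun measurableSet_Ioi fun t ht => ?_
  have ht : 0 < t := ht
  simp only [norm_mul]
  rw [Complex.norm_cpow_eq_rpow_re_of_pos ht]
  rw [Complex.norm_of_nonneg (Real.exp_pos _).le]
  simp [mul_comm]

lemma norm_zeta_le16 {w : ℂ} (hw : 1 < w.re) :
    ‖riemannZeta w‖ ≤ ∑' n : ℕ, 1 / ((n + 1 : ℕ) : ℝ) ^ w.re := by
  rw [zeta_eq_tsum_one_div_nat_add_one_cpow hw]
  have hsum : Summable fun n : ℕ => 1 / ((n + 1 : ℕ) : ℝ) ^ w.re :=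
      (summable_nat_add_iff 1).mpr (Real.summable_one_div_nat_rpow.mpr hw)
  refine tsum_of_norm_bounded hsum.hasSum fun n => le_of_eq ?_
  rw [norm_div, norm_one]
  congr 1
  have := Complex.norm_cpow_eq_rpow_re_of_pos (x := (n : ℝ) + 1) (by positivity) w
  push_cast at this ⊢
  exact this

lemma vertical16 {ρ Δ : ℝ} (hρ : 0 < ρ) (hΔ : 1 < Δ) :
    Integrable fun y : ℝ => Complex.Gamma ((Δ : ℂ) + (y : ℂ) * Complex.I + ρ) *
          riemannZeta ((Δ : ℂ) + (y : ℂ) * Complex.I + ρ + 1) /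
          ((Δ : ℂ) + (y : ℂ) * Complex.I) := by
  set Z := ∑' n : ℕ, 1 / ((n + 1 : ℕ) : ℝ) ^ (Δ + ρ + 1) with hZ
  have hZ0 : 0 ≤ Z := tsum_nonneg fun n => by positivity
  have hG0 : 0 < Real.Gamma (Δ + ρ + 1) := Real.Gamma_pos_of_pos (by linarith)
  refine ((integrable_inv_one_add_sq).const_mul (Real.Gamma (Δ + ρ + 1) * Z)).mono' ?_ ?_
  · refine Continuous.aestronglyMeasurable ?_
    refine continuous_iff_continuousAt.mpr fun y => ?_
    refine ContinuousAt.div (ContinuousAt.mul ?_ ?_) (by fun_prop) ?_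
    · refine ContinuousAt.comp (f := fun y : ℝ => (Δ : ℂ) + (y : ℂ) * Complex.I + ρ)
        (g := Complex.Gamma) ?_ (by fun_prop)
      refine (Complex.differentiableAt_Gamma _ fun m h => ?_).continuousAt
      have := congrArg Complex.re h
      simp at this
      have : (0 : ℝ) ≤ m := by positivity
      linarith
    · refine ContinuousAt.comp (f := fun y : ℝ => (Δ : ℂ) + (y : ℂ) * Complex.I + ρ + 1)
        (g := riemannZeta) ?_ (by fun_prop)
      refine (differentiableAt_riemannZeta fun h => ?_).continuousAt
      have := congrArg Complex.re h
      simp at this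
      linarith
    · intro h
      have := congrArg Complex.re h
      simp at this
      linarith
  · refine Eventually.of_forall fun y => ?_
    set s : ℂ := (Δ : ℂ) + (y : ℂ) * Complex.I with hs
    have hsre : s.re = Δ := by simp [hs]
    have hsim : s.im = y := by simp [hs]
    have hw0 : s + ρ ≠ 0 := by
      intro h
      have := congrArg Complex.re h
      simp [hsre] at this
      linarith
    have hG : ‖Complex.Gamma (s + ρ)‖ * ‖s + ρ‖ ≤ Real.Gamma (Δ + ρ + 1) := by
      rw [← norm_mul, mul_comm, ← Complex.Gamma_add_one _ hw0]
      refine (norm_Gamma_le16 (by simp [hsre]; linarith)).trans (le_of_eq ?_)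
      simp [hsre]
    have hz : ‖riemannZeta (s + ρ + 1)‖ ≤ Z := by
      refine (norm_zeta_le16 (by simp [hsre]; linarith)).trans (le_of_eq ?_)
      simp [hsre, hZ]
    have n1 : 1 + y ^ 2 ≤ ‖s‖ ^ 2 := by
      rw [← Complex.normSq_eq_norm_sq, Complex.normSq_apply, hsre, hsim]; nlinarith
    have n2 : ‖s‖ ≤ ‖s + ρ‖ := by
      refine (sq_le_sq₀ (norm_nonneg _) (norm_nonneg _)).mp ?_
      rw [← Complex.normSq_eq_norm_sq, ← Complex.normSq_eq_norm_sq, Complex.normSq_apply,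
        Complex.normSq_apply]
      simp only [Complex.add_re, Complex.add_im, Complex.ofReal_re, Complex.ofReal_im, hsre, hsim]
      nlinarith
    have hspos : 0 < ‖s‖ := by
      by_contra h
      have : ‖s‖ = 0 := le_antisymm (not_lt.mp h) (norm_nonneg _)
      rw [this] at n1
      nlinarith
    have hG2 : ‖Complex.Gamma (s + ρ)‖ * ‖s‖ ≤ Real.Gamma (Δ + ρ + 1) :=
      (mul_le_mul_of_nonneg_left n2 (norm_nonneg _)).trans hG
    rw [norm_div, norm_mul, div_le_iff₀ hspos]
    have hy : 0 < 1 + y ^ 2 := by positivity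
    have hmul := mul_le_mul hG2 hz (norm_nonneg _) hG0.le
    calc ‖Complex.Gamma (s + ρ)‖ * ‖riemannZeta (s + ρ + 1)‖
        = (‖Complex.Gamma (s + ρ)‖ * ‖s‖ * ‖riemannZeta (s + ρ + 1)‖) / ‖s‖ := by field_simp
      _ ≤ (Real.Gamma (Δ + ρ + 1) * Z) / ‖s‖ := by gcongr
      _ = (Real.Gamma (Δ + ρ + 1) * Z) * (‖s‖ ^ 2)⁻¹ * ‖s‖ := by field_simp
      _ ≤ (Real.Gamma (Δ + ρ + 1) * Z) * (1 + y ^ 2)⁻¹ * ‖s‖ := by gcongr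

theorem statement16 (ρ Δ u : ℝ) (hρ : 0 < ρ) (hΔ : 1 < Δ) (hu : 0 < u) :
    ((1 / (2 * π) : ℝ) : ℂ) * ∫ y : ℝ,
        (u : ℂ) ^ (-((Δ : ℂ) + (y : ℂ) * Complex.I)) *
          Complex.Gamma ((Δ : ℂ) + (y : ℂ) * Complex.I + ρ) *
          riemannZeta ((Δ : ℂ) + (y : ℂ) * Complex.I + ρ + 1) /
          ((Δ : ℂ) + (y : ℂ) * Complex.I)
      = ((-∫ y in Set.Ioi u, y ^ (ρ - 1) * Real.log (1 - Real.exp (-y)) : ℝ) : ℂ) := by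
  let g : ℝ → ℂ := fun y => (y : ℂ) ^ ((ρ : ℂ) - 1) • Lc16 y
  have hgm : Measurable g := by
    unfold g Lc16
    fun_prop
  have hgi : IntegrableOn g (Set.Ioi 0) := mellinConvergent_Lc16 (s := (ρ : ℂ)) (by simpa using hρ)
  let H : ℝ → ℂ := fun u => ∫ y in Set.Ioi u, g y
  have hkey : ∀ s : ℂ, s.re = Δ → MellinConvergent H s ∧
      mellin H s = Complex.Gamma (s + ρ) * riemannZeta (s + ρ + 1) / s := by
    intro s hs
    have e : s + 1 + ((ρ : ℂ) - 1) = s + ρ := by ring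
    have hpos : 0 < (s + ρ).re := by simp [hs]; linarith
    obtain ⟨h1, h2⟩ := mellin_tail16 hgm (s := s) (by linarith)
      (by
        refine MellinConvergent.cpow_smul.mpr ?_
        rw [e]
        exact mellinConvergent_Lc16 hpos)
    refine ⟨h1, h2.trans ?_⟩
    rw [mellin_cpow_smul, e, mellin_Lc16 hpos]
  have hre : ∀ y : ℝ, ((Δ : ℂ) + (y : ℂ) * Complex.I).re = Δ := by intro y; simp
  have hcont : ContinuousAt H u := by
    let G : ℝ → ℂ := (Set.Ioi 0).indicator g
    have hG : Integrable G := (integrable_indicator_iff measurableSet_Ioi).mpr hgi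
    have hc := intervalIntegral.continuous_primitive (f := G) (μ := volume)
      (fun a b => hG.intervalIntegrable) 0
    have hc2 : ContinuousAt (fun b => (∫ x in Set.Ioi 0, g x) - ∫ x in (0:ℝ)..b, G x) u :=
      (continuous_const.sub hc).continuousAt
    refine hc2.congr ?_
    filter_upwards [lt_mem_nhds hu] with b hb
    have h3 : ∫ x in (0:ℝ)..b, G x = ∫ x in (0:ℝ)..b, g x := by
      rw [intervalIntegral.integral_of_le hb.le, intervalIntegral.integral_of_le hb.le]
      refine setIntegral_congr_fun measurableSet_Ioc fun x hx => ?_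
      exact Set.indicator_of_mem hx.1 _
    rw [h3, ← intervalIntegral.integral_Ioi_sub_Ioi hgi hb.le]
    simp [H]
  have hinv := mellinInv_mellin_eq Δ H hu (hkey Δ (by simp)).1
    (by
      refine (vertical16 hρ hΔ).congr (Eventually.of_forall fun y => ?_)
      exact ((hkey _ (hre y)).2).symm) hcont
  have hH : H u = ((-∫ y in Set.Ioi u, y ^ (ρ - 1) * Real.log (1 - Real.exp (-y)) : ℝ) : ℂ) := by
    rw [← integral_neg, ← integral_complex_ofReal]
    refine setIntegral_congr_fun measurableSet_Ioi fun y hy => ?_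
    have hy0 : 0 < y := hu.trans hy
    simp only [g, Lc16, smul_eq_mul]
    push_cast
    rw [Complex.ofReal_cpow hy0.le]
    push_cast
    ring
  rw [← hH, ← hinv, mellinInv, ← Complex.coe_smul, smul_eq_mul]
  congr 2
  ext y
  rw [(hkey _ (hre y)).2, smul_eq_mul]
  ring
end
end

section
/- Assume the weight sequence b satisfies conditions (M1) and (M2), let α_n be the unique positive solution of 𝒜_b(e^{−α}) = n, and let m = m(n) be a sequence of positive integers with m(n) ~ ρ α_n^{−1} log(α_n^{−1}) as n → ∞. Then F_{m,b}(e^{−α_n}) − F_b(e^{−α_n}) = A α_n^{−ρ} ∫_{(m+1)α_n}^{∞} y^{ρ−1} log(1 − e^{−y}) dy + o(1) as n → ∞ (equivalently, exp{F_{m,b}(e^{−α_n}) − F_b(e^{−α_n})} ~ exp{−A α_n^{−ρ} H((m+1)α_n)} with H(u) = −∫_u^∞ y^{ρ−1} log(1 − e^{−y}) dy). -/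
open Filter Topology Asymptotics MeasureTheory Real

noncomputable section

/-- Nondecreasing, supported on `[0,∞)`, and at most exponential growth of rate `c`. -/
def NiceFn (c : ℝ) (f : ℝ → ℝ) : Prop :=
  Monotone f ∧ (∀ t < 0, f t = 0) ∧ ∃ C : ℝ, 0 ≤ C ∧ ∀ t, f t ≤ C * Real.exp (c * t)

/-- Primitive from `0`. -/
def primFn (f : ℝ → ℝ) (t : ℝ) : ℝ := ∫ u in (0:ℝ)..t, f u

/-- Laplace transform. -/
def lapFn (f : ℝ → ℝ) (s : ℂ) : ℂ := ∫ t in Set.Ioi (0:ℝ), (f t : ℂ) * Complex.exp (-s * t)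

lemma NiceFn.nonneg {c : ℝ} {f : ℝ → ℝ} (h : NiceFn c f) (t : ℝ) : 0 ≤ f t := by
  have h1 : f (min t (-1)) = 0 := h.2.1 _ (lt_of_le_of_lt (min_le_right _ _) (by norm_num))
  rw [← h1]; exact h.1 (min_le_left _ _)

lemma NiceFn.ii {c : ℝ} {f : ℝ → ℝ} (h : NiceFn c f) (a b : ℝ) :
    IntervalIntegrable f volume a b := h.1.intervalIntegrable

lemma NiceFn.prim_sub {c : ℝ} {f : ℝ → ℝ} (h : NiceFn c f) (a b : ℝ) :
    primFn f b - primFn f a = ∫ u in a..b, f u :=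
  intervalIntegral.integral_interval_sub_left (h.ii _ _) (h.ii _ _)

lemma NiceFn.prim_neg {c : ℝ} {f : ℝ → ℝ} (h : NiceFn c f) {t : ℝ} (ht : t ≤ 0) :
    primFn f t = 0 := by
  unfold primFn
  rw [intervalIntegral.integral_symm, intervalIntegral.integral_of_le ht,
    MeasureTheory.integral_Ioc_eq_integral_Ioo,
    setIntegral_congr_fun (g := fun _ => (0:ℝ)) measurableSet_Ioo (fun x hx => h.2.1 x hx.2)]
  simp

lemma NiceFn.prim_sub_le {c : ℝ} {f : ℝ → ℝ} (h : NiceFn c f) {a b : ℝ} (hab : a ≤ b) :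
    primFn f b - primFn f a ≤ (b - a) * f b := by
  rw [h.prim_sub]
  have := intervalIntegral.integral_mono_on hab (h.ii a b) (intervalIntegrable_const (c := f b))
    (fun x hx => h.1 hx.2)
  simpa using this

lemma NiceFn.le_prim_sub {c : ℝ} {f : ℝ → ℝ} (h : NiceFn c f) {a b : ℝ} (hab : a ≤ b) :
    (b - a) * f a ≤ primFn f b - primFn f a := by
  rw [h.prim_sub]
  have := intervalIntegral.integral_mono_on hab (intervalIntegrable_const (c := f a)) (h.ii a b)
    (fun x hx => h.1 hx.1)
  simpa using this

lemma NiceFn.prim_mono {c : ℝ} {f : ℝ → ℝ} (h : NiceFn c f) : Monotone (primFn f) := by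
  intro a b hab
  have := h.le_prim_sub hab
  have h2 : 0 ≤ (b - a) * f a := mul_nonneg (by linarith) (h.nonneg a)
  linarith

lemma NiceFn.prim {c : ℝ} (hc : 0 < c) {f : ℝ → ℝ} (h : NiceFn c f) : NiceFn c (primFn f) := by
  refine ⟨h.prim_mono, fun t ht => h.prim_neg ht.le, ?_⟩
  obtain ⟨C, hC, hb⟩ := h.2.2
  refine ⟨C / c, by positivity, fun t => ?_⟩
  rcases le_total t 0 with ht | ht
  · rw [h.prim_neg ht]; positivity
  · have h1 : primFn f t ≤ ∫ u in (0:ℝ)..t, C * Real.exp (c * u) := by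
      apply intervalIntegral.integral_mono_on ht (h.ii _ _)
      · apply Continuous.intervalIntegrable; fun_prop
      · intro x _; exact hb x
    have h2 : ∫ u in (0:ℝ)..t, C * Real.exp (c * u) = C / c * (Real.exp (c * t) - 1) := by
      rw [intervalIntegral.integral_const_mul, intervalIntegral.integral_comp_mul_left _ hc.ne']
      simp; ring
    rw [h2] at h1
    have : 0 ≤ C / c := by positivity
    nlinarith

lemma NiceFn.prim_cont {c : ℝ} {f : ℝ → ℝ} (h : NiceFn c f) : Continuous (primFn f) :=
  intervalIntegral.continuous_primitive (fun a b => h.ii a b) 0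

lemma NiceFn.meas {c : ℝ} {f : ℝ → ℝ} (h : NiceFn c f) : Measurable f := h.1.measurable

lemma NiceFn.norm_lap_le {c : ℝ} {f : ℝ → ℝ} (h : NiceFn c f) :
    ∃ C : ℝ, 0 ≤ C ∧ ∀ (s : ℂ) (t : ℝ),
      ‖(f t : ℂ) * Complex.exp (-s * t)‖ ≤ C * Real.exp (-(s.re - c) * t) := by
  obtain ⟨C, hC, hb⟩ := h.2.2
  refine ⟨C, hC, fun s t => ?_⟩
  rw [norm_mul, Complex.norm_exp, Complex.norm_real, Real.norm_of_nonneg (h.nonneg t)]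
  have : (-s * (t:ℂ)).re = -s.re * t := by simp
  rw [this]
  calc f t * Real.exp (-s.re * t) ≤ C * Real.exp (c * t) * Real.exp (-s.re * t) := by
        gcongr; exact hb t
    _ = _ := by rw [mul_assoc, ← Real.exp_add]; ring_nf

lemma NiceFn.integrable_lap {c : ℝ} {f : ℝ → ℝ} (h : NiceFn c f) {s : ℂ} (hs : c < s.re) :
    IntegrableOn (fun t : ℝ => (f t : ℂ) * Complex.exp (-s * t)) (Set.Ioi 0) := by
  obtain ⟨C, hC, hb⟩ := h.norm_lap_le
  have h1 : IntegrableOn (fun t : ℝ => C * Real.exp (-(s.re - c) * t)) (Set.Ioi 0) :=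
    (integrableOn_exp_mul_Ioi (by linarith) 0).const_mul C
  refine h1.mono' ?_ (Eventually.of_forall fun t => hb s t)
  have := h.meas
  apply Measurable.aestronglyMeasurable
  fun_prop

lemma NiceFn.lap_prim {c : ℝ} (hc : 0 < c) {f : ℝ → ℝ} (h : NiceFn c f) {s : ℂ} (hs : c < s.re) :
    lapFn (primFn f) s = lapFn f s / s := by
  have hs0 : s ≠ 0 := by rintro rfl; simp at hs; linarith
  have hP := h.prim hc
  have hi1 := h.integrable_lap hs
  have hi2 := hP.integrable_lap hs
  set G : ℝ → ℂ := fun t => (primFn f t : ℂ) * Complex.exp (-s * t) with hG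
  set G' : ℝ → ℂ := fun t => (f t : ℂ) * Complex.exp (-s * t) -
      s * ((primFn f t : ℂ) * Complex.exp (-s * t)) with hG'
  have hiG' : IntegrableOn G' (Set.Ioi 0) := hi1.sub (hi2.const_mul s)
  have hder : ∀ t : ℝ, ContinuousAt f t → HasDerivAt G (G' t) t := by
    intro t ht
    have d1 : HasDerivAt (primFn f) (f t) t :=
      intervalIntegral.integral_hasDerivAt_right (h.ii _ _)
        (h.meas.stronglyMeasurable.stronglyMeasurableAtFilter) ht
    have d2 : HasDerivAt (fun t : ℝ => Complex.exp (-s * t)) (Complex.exp (-s * t) * (-s)) t := by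
      have : HasDerivAt (fun t : ℝ => -s * (t:ℂ)) (-s) t := by
        simpa using (Complex.ofRealCLM.hasDerivAt (x := t)).const_mul (-s)
      exact this.cexp
    refine (d1.ofReal_comp.mul d2).congr_deriv ?_
    change _ = (f t : ℂ) * Complex.exp (-s * t) - s * ((primFn f t : ℂ) * Complex.exp (-s * t))
    ring
  have hcont : Continuous G := by
    have := h.prim_cont
    fun_prop
  have hFTC : ∀ T : ℝ, 0 ≤ T → ∫ t in (0:ℝ)..T, G' t = G T := by
    intro T hT
    have := MeasureTheory.integral_eq_of_hasDerivAt_off_countable G G' (a := 0) (b := T)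
      h.1.countable_not_continuousAt hcont.continuousOn
      (fun x hx => hder x (by simpa using hx.2))
      ((intervalIntegrable_iff_integrableOn_Ioc_of_le hT).2
        (hiG'.mono_set Set.Ioc_subset_Ioi_self))
    rw [this]
    have h0 : G 0 = 0 := by
      change (primFn f 0 : ℂ) * _ = 0
      rw [h.prim_neg le_rfl]; simp
    rw [h0, sub_zero]
  have hlim1 := MeasureTheory.intervalIntegral_tendsto_integral_Ioi 0 hiG' tendsto_id
  have hlim2 : Tendsto G atTop (𝓝 0) := by
    obtain ⟨C, hC, hb⟩ := hP.norm_lap_le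
    refine squeeze_zero_norm (fun t => hb s t) ?_
    have : Tendsto (fun t : ℝ => Real.exp (-(s.re - c) * t)) atTop (𝓝 0) := by
      apply Real.tendsto_exp_atBot.comp
      exact tendsto_id.const_mul_atTop_of_neg (by linarith)
    simpa using this.const_mul C
  have hz : ∫ t in Set.Ioi (0:ℝ), G' t = 0 := by
    refine tendsto_nhds_unique hlim1 (hlim2.congr' ?_)
    filter_upwards [eventually_ge_atTop 0] with T hT
    exact (hFTC T hT).symm
  rw [hG', integral_sub hi1 (hi2.const_mul s), integral_const_mul] at hz
  unfold lapFn
  rw [eq_div_iff hs0]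
  linear_combination -hz

lemma tauber_step {c ρ δ C : ℝ} {E f : ℝ → ℝ} (hδ : 0 ≤ δ) (hδρ : δ ≤ ρ) (hρ : 0 < ρ)
    (hE : NiceFn c E) (hf : NiceFn ρ f)
    (hC : 0 ≤ C)
    (hb : ∀ t, |primFn E t - primFn (primFn f) t| ≤ C * Real.exp ((ρ - δ) * t)) :
    ∃ C', 0 ≤ C' ∧ ∀ t, |E t - primFn f t| ≤ C' * Real.exp ((ρ - δ / 2) * t) := by
  obtain ⟨B, hB, hfB⟩ := hf.2.2
  have hM := hf.prim hρ
  refine ⟨B * Real.exp ρ + 2 * C * Real.exp ρ, by positivity, fun t => ?_⟩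
  rcases lt_or_ge t 0 with ht | ht
  · rw [hE.2.1 t ht, hf.prim_neg ht.le]; simp; positivity
  set h := Real.exp (-(δ / 2) * t) with hh
  have hh0 : 0 < h := Real.exp_pos _
  have hh1 : h ≤ 1 := by
    rw [hh]; apply Real.exp_le_one_iff.2; nlinarith
  have key1 : Real.exp (ρ * t) * h = Real.exp ((ρ - δ / 2) * t) := by
    rw [hh, ← Real.exp_add]; ring_nf
  have key2 : Real.exp ((ρ - δ) * t) = h * Real.exp ((ρ - δ / 2) * t) := by
    rw [hh, ← Real.exp_add]; ring_nf
  have he1 : 1 ≤ Real.exp ρ := Real.one_le_exp hρ.le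
  have u1 := hE.le_prim_sub (a := t) (b := t + h) (by linarith)
  have u2 := hM.prim_sub_le (a := t) (b := t + h) (by linarith)
  have u3 := hf.prim_sub_le (a := t) (b := t + h) (by linarith)
  have u4 := hE.prim_sub_le (a := t - h) (b := t) (by linarith)
  have u5 := hM.le_prim_sub (a := t - h) (b := t) (by linarith)
  have u6 := hf.prim_sub_le (a := t - h) (b := t) (by linarith)
  have b0 := abs_le.1 (hb t)
  have b1 := abs_le.1 (hb (t + h))
  have b2 := abs_le.1 (hb (t - h))
  have e1 : Real.exp ((ρ - δ) * (t + h)) ≤ Real.exp ρ * Real.exp ((ρ - δ) * t) := by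
    rw [← Real.exp_add]; apply Real.exp_le_exp.2; nlinarith
  have e2 : Real.exp ((ρ - δ) * (t - h)) ≤ Real.exp ρ * Real.exp ((ρ - δ) * t) := by
    rw [← Real.exp_add]; apply Real.exp_le_exp.2; nlinarith
  have e0 : Real.exp ((ρ - δ) * t) ≤ Real.exp ρ * Real.exp ((ρ - δ) * t) := by
    nlinarith [Real.exp_pos ((ρ - δ) * t)]
  have f1 : f (t + h) ≤ B * (Real.exp ρ * Real.exp (ρ * t)) := by
    refine (hfB _).trans ?_
    gcongr
    rw [← Real.exp_add]; apply Real.exp_le_exp.2; nlinarith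
  have f2 : f t ≤ B * (Real.exp ρ * Real.exp (ρ * t)) := by
    refine (hfB _).trans ?_
    gcongr
    nlinarith [Real.exp_pos (ρ * t)]
  have g1 := mul_le_mul_of_nonneg_left e1 hC
  have g2 := mul_le_mul_of_nonneg_left e2 hC
  have g0 := mul_le_mul_of_nonneg_left e0 hC
  rw [key2] at g1 g2 g0 b0
  set X := Real.exp ((ρ - δ / 2) * t)
  have k1 := mul_le_mul_of_nonneg_left f1 hh0.le
  have k2 := mul_le_mul_of_nonneg_left f2 hh0.le
  have k3 : h * (B * (Real.exp ρ * Real.exp (ρ * t))) = B * Real.exp ρ * X := by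
    rw [← key1]; ring
  rw [k3] at k1 k2
  simp only [add_sub_cancel_left, sub_sub_cancel] at u1 u2 u3 u4 u5 u6
  have v3 := mul_le_mul_of_nonneg_left u3 hh0.le
  have v6 := mul_le_mul_of_nonneg_left u6 hh0.le
  have k1' := mul_le_mul_of_nonneg_left k1 hh0.le
  have k2' := mul_le_mul_of_nonneg_left k2 hh0.le
  rw [abs_le]
  constructor
  · refine le_of_mul_le_mul_left ?_ hh0
    linarith
  · refine le_of_mul_le_mul_left ?_ hh0
    linarith

lemma tauber_iter {c ρ : ℝ} {E f : ℝ → ℝ} (hc : 0 < c) (hρ : 0 < ρ)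
    (hE : NiceFn c E) (hf : NiceFn ρ f) (N : ℕ) :
    ∀ δ : ℝ, 0 < δ → δ ≤ ρ → ∀ C, 0 ≤ C →
    (∀ t, |primFn^[N] E t - primFn^[N] (primFn f) t| ≤ C * Real.exp ((ρ - δ) * t)) →
    ∃ δ', 0 < δ' ∧ δ' ≤ ρ ∧ ∃ C', 0 ≤ C' ∧
      ∀ t, |E t - primFn f t| ≤ C' * Real.exp ((ρ - δ') * t) := by
  induction N generalizing E f with
  | zero => intro δ h1 h2 C hC hb; exact ⟨δ, h1, h2, C, hC, hb⟩
  | succ N ih =>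
    intro δ h1 h2 C hC hb
    simp only [Function.iterate_succ, Function.comp] at hb
    obtain ⟨δ', h1', h2', C', hC', hb'⟩ := ih (hE.prim hc) (hf.prim hρ) δ h1 h2 C hC hb
    obtain ⟨C'', hC'', hb''⟩ := tauber_step h1'.le h2' hρ hE hf hC' hb'
    exact ⟨δ' / 2, by linarith, by linarith, C'', hC'', hb''⟩

lemma NiceFn.iter {c : ℝ} (hc : 0 < c) (N : ℕ) {f : ℝ → ℝ} (h : NiceFn c f) :
    NiceFn c (primFn^[N] f) := by
  induction N generalizing f with
  | zero => exact h
  | succ N ih => exact ih (h.prim hc)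

lemma NiceFn.lap_iter {c : ℝ} (hc : 0 < c) (N : ℕ) {f : ℝ → ℝ} (h : NiceFn c f) {s : ℂ}
    (hs : c < s.re) : lapFn (primFn^[N] f) s = lapFn f s / s ^ N := by
  induction N generalizing f with
  | zero => simp
  | succ N ih =>
    rw [Function.iterate_succ, Function.comp, ih (h.prim hc), h.lap_prim hc hs, div_div, pow_succ']

lemma contour_shift (L : ℂ → ℂ) {a b K : ℝ} (hab : a ≤ b)
    (hd : ∀ s : ℂ, a ≤ s.re → s.re ≤ b → DifferentiableAt ℂ L s)
    (hL : ∀ s : ℂ, a ≤ s.re → s.re ≤ b → ‖L s‖ ≤ K * (1 + s.im ^ 2)⁻¹) (t : ℝ) :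
    Integrable (fun y : ℝ => Complex.exp ((b + y * Complex.I) * t) * L (b + y * Complex.I)) ∧
    ‖∫ y : ℝ, Complex.exp ((b + y * Complex.I) * t) * L (b + y * Complex.I)‖
      ≤ K * π * Real.exp (a * t) := by
  set f : ℂ → ℂ := fun s => Complex.exp (s * t) * L s with hf
  have hK : 0 ≤ K := by
    have := (norm_nonneg _).trans (hL (a : ℂ) (by simp) (by simpa using hab))
    simpa using this
  have hfd : ∀ s : ℂ, a ≤ s.re → s.re ≤ b → DifferentiableAt ℂ f s := by
    intro s h1 h2
    have := hd s h1 h2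
    fun_prop
  have hfn : ∀ s : ℂ, a ≤ s.re → s.re ≤ b →
      ‖f s‖ ≤ Real.exp (s.re * t) * (K * (1 + s.im ^ 2)⁻¹) := by
    intro s h1 h2
    rw [hf]
    simp only [norm_mul, Complex.norm_exp]
    have : (s * (t:ℂ)).re = s.re * t := by simp
    rw [this]
    gcongr
    exact hL s h1 h2
  have hline : ∀ x : ℝ, a ≤ x → x ≤ b → Integrable (fun y : ℝ => f (x + y * Complex.I)) := by
    intro x h1 h2
    have hg : Integrable (fun y : ℝ => Real.exp (x * t) * (K * (1 + y ^ 2)⁻¹)) :=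
      (integrable_inv_one_add_sq.const_mul K).const_mul _
    refine hg.mono' ?_ (Eventually.of_forall fun y => ?_)
    · apply Continuous.aestronglyMeasurable
      rw [continuous_iff_continuousAt]
      intro y
      have h3 : ContinuousAt f (x + y * Complex.I) :=
        (hfd _ (by simpa using h1) (by simpa using h2)).continuousAt
      have h4 : ContinuousAt (fun y : ℝ => (x + y * Complex.I : ℂ)) y := by fun_prop
      exact ContinuousAt.comp (f := fun y : ℝ => (x + y * Complex.I : ℂ)) h3 h4
    · simpa using hfn (x + y * Complex.I) (by simpa using h1) (by simpa using h2)
  have hrect : ∀ T : ℝ, (((∫ x : ℝ in a..b, f (x + (-T : ℝ) * Complex.I)) -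
      ∫ x : ℝ in a..b, f (x + (T : ℝ) * Complex.I)) +
      Complex.I • ∫ y : ℝ in (-T)..T, f (b + y * Complex.I)) -
      Complex.I • ∫ y : ℝ in (-T)..T, f (a + y * Complex.I) = 0 := by
    intro T
    have := Complex.integral_boundary_rect_eq_zero_of_differentiableOn f ⟨a, -T⟩ ⟨b, T⟩ (by
      intro s hs
      have h1 := hs.1
      simp only [Set.uIcc_of_le hab, Set.mem_preimage, Set.mem_Icc] at h1
      exact (hfd s h1.1 h1.2).differentiableWithinAt)
    simpa using this
  have hhor : ∀ ε : ℝ, ε ^ 2 = 1 →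
      Tendsto (fun T : ℝ => ∫ x : ℝ in a..b, f (x + (ε * T : ℝ) * Complex.I)) atTop (𝓝 0) := by
    intro ε hε
    have hbd : ∀ T : ℝ, ‖∫ x : ℝ in a..b, f (x + (ε * T : ℝ) * Complex.I)‖ ≤
        (Real.exp (|a * t| + |b * t|) * (K * (1 + T ^ 2)⁻¹)) * |b - a| := by
      intro T
      apply intervalIntegral.norm_integral_le_of_norm_le_const
      intro x hx
      rw [Set.uIoc_of_le hab] at hx
      have := hfn (x + (ε * T : ℝ) * Complex.I) (by simpa using hx.1.le) (by simpa using hx.2)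
      refine this.trans ?_
      have him : ((x : ℂ) + ((ε * T : ℝ) : ℂ) * Complex.I).im = ε * T := by simp
      have hre : ((x : ℂ) + ((ε * T : ℝ) : ℂ) * Complex.I).re = x := by simp
      rw [him, hre, mul_pow, hε, one_mul]
      gcongr
      rcases le_total 0 t with ht | ht
      · have : x * t ≤ b * t := by nlinarith [hx.2]
        linarith [le_abs_self (b * t), abs_nonneg (a * t)]
      · have : x * t ≤ a * t := by nlinarith [hx.1]
        linarith [le_abs_self (a * t), abs_nonneg (b * t)]
    refine squeeze_zero_norm hbd ?_
    have h1 : Tendsto (fun T : ℝ => (1 + T ^ 2)⁻¹) atTop (𝓝 0) :=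
      tendsto_inv_atTop_zero.comp
        (tendsto_atTop_add_const_left _ _ (tendsto_pow_atTop (by norm_num)))
    simpa using ((h1.const_mul K).const_mul (Real.exp (|a * t| + |b * t|))).mul_const |b - a|
  have hIb := MeasureTheory.intervalIntegral_tendsto_integral (hline b hab le_rfl)
    tendsto_neg_atTop_atBot tendsto_id
  have hIa := MeasureTheory.intervalIntegral_tendsto_integral (hline a le_rfl hab)
    tendsto_neg_atTop_atBot tendsto_id
  have hh1 := hhor (-1) (by norm_num)
  have hh2 := hhor 1 (by norm_num)
  simp only [neg_mul, one_mul] at hh1 hh2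
  have hlim := ((hh1.sub hh2).add (hIb.const_smul Complex.I)).sub (hIa.const_smul Complex.I)
  have hz := tendsto_nhds_unique hlim (tendsto_const_nhds.congr fun T => (hrect T).symm)
  have heq : ∫ y : ℝ, f (b + y * Complex.I) = ∫ y : ℝ, f (a + y * Complex.I) := by
    simp only [sub_zero, zero_add, smul_eq_mul] at hz
    have : Complex.I * ((∫ y : ℝ, f (b + y * Complex.I)) - ∫ y : ℝ, f (a + y * Complex.I)) = 0 := by
      rw [mul_sub]; exact hz
    rcases mul_eq_zero.1 this with h | h
    · exact absurd h Complex.I_ne_zero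
    · exact sub_eq_zero.1 h
  refine ⟨hline b hab le_rfl, ?_⟩
  change ‖∫ y : ℝ, f (b + y * Complex.I)‖ ≤ _
  rw [heq]
  have hg : Integrable (fun y : ℝ => Real.exp (a * t) * (K * (1 + y ^ 2)⁻¹)) :=
      (integrable_inv_one_add_sq.const_mul K).const_mul _
  refine (norm_integral_le_of_norm_le hg (Eventually.of_forall fun y => ?_)).trans ?_
  · simpa using hfn (a + y * Complex.I) (by simp) (by simpa using hab)
  · rw [integral_const_mul, integral_const_mul, integral_univ_inv_one_add_sq]
    apply le_of_eq; ring

lemma laplace_inv_bound (P : ℝ → ℝ) (L : ℂ → ℂ) {a b K : ℝ} (hab : a ≤ b)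
    (hPc : Continuous P) (hP0 : ∀ t ≤ 0, P t = 0)
    (hPi : IntegrableOn (fun t : ℝ => (P t : ℂ) * Complex.exp (-(b:ℂ) * t)) (Set.Ioi 0))
    (hPL : ∀ s : ℂ, s.re = b → lapFn P s = L s)
    (hd : ∀ s : ℂ, a ≤ s.re → s.re ≤ b → DifferentiableAt ℂ L s)
    (hL : ∀ s : ℂ, a ≤ s.re → s.re ≤ b → ‖L s‖ ≤ K * (1 + s.im ^ 2)⁻¹) (t : ℝ) :
    |P t| ≤ K / 2 * Real.exp (a * t) := by
  set f : ℝ → ℂ := fun t => (P t : ℂ) * Complex.exp (-(b:ℂ) * t) with hf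
  have hfc : Continuous f := by fun_prop
  have hfz : ∀ t ∉ Set.Ioi (0:ℝ), f t = 0 := by
    intro t ht
    simp only [Set.mem_Ioi, not_lt] at ht
    simp [hf, hP0 t ht]
  have hfi : Integrable f := by
    rw [← integrableOn_univ]
    exact (integrableOn_iff_integrable_of_support_subset (s := Set.Ioi 0) (by
      intro x hx; by_contra h; exact hx (hfz x h))).1 hPi |>.integrableOn
  have hF : ∀ w : ℝ, FourierTransform.fourier f w = L (b + (2 * π * w : ℝ) * Complex.I) := by
    intro w
    rw [← hPL _ (by simp), Real.fourier_eq', lapFn,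
      ← setIntegral_eq_integral_of_forall_compl_eq_zero (s := Set.Ioi 0)]
    · apply setIntegral_congr_fun measurableSet_Ioi
      intro x _
      simp only [hf, smul_eq_mul, mul_left_comm _ (P x : ℂ), ← Complex.exp_add]
      congr 2
      simp only [RCLike.inner_apply, conj_trivial]
      push_cast
      ring
    · intro x hx
      rw [hfz x hx, smul_zero]
  obtain ⟨hI0, -⟩ := contour_shift L hab hd hL 0
  obtain ⟨hIt, hbt⟩ := contour_shift L hab hd hL t
  have hpi : (2 * π) ≠ 0 := by positivity
  have hFi : Integrable (FourierTransform.fourier f) := by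
    have h1 : Integrable (fun y : ℝ => L (b + y * Complex.I)) := by simpa using hI0
    have h2 := h1.comp_mul_left' hpi
    exact h2.congr (Eventually.of_forall fun w => (hF w).symm)
  have hinv := hfi.fourierInv_fourier_eq hFi (hfc.continuousAt (x := t))
  rw [Real.fourierInv_eq'] at hinv
  have h3 : (∫ v : ℝ, Complex.exp (((2 * π * inner ℝ v t : ℝ) : ℂ) * Complex.I) •
      FourierTransform.fourier f v) =
      ∫ v : ℝ, (fun y : ℝ => Complex.exp (-(b:ℂ) * t) *
        (Complex.exp ((b + y * Complex.I) * t) * L (b + y * Complex.I))) (2 * π * v) := by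
    congr 1
    ext v
    rw [hF]
    simp only [smul_eq_mul, ← mul_assoc, ← Complex.exp_add]
    congr 2
    simp only [RCLike.inner_apply, conj_trivial]
    push_cast
    ring
  have hcm := Measure.integral_comp_mul_left (fun y : ℝ => Complex.exp (-(b:ℂ) * t) *
        (Complex.exp ((b + y * Complex.I) * t) * L (b + y * Complex.I))) (2 * π)
  rw [h3] at hinv
  replace hinv := hcm.symm.trans hinv
  rw [integral_const_mul] at hinv
  have h4 : ‖f t‖ = |P t| * Real.exp (-b * t) := by
    simp [hf, Complex.norm_exp]
  have h5 : |P t| * Real.exp (-b * t) ≤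
      (2 * π)⁻¹ * (Real.exp (-b * t) * (K * π * Real.exp (a * t))) := by
    rw [← h4, ← hinv, norm_smul, norm_mul, Complex.norm_exp]
    have e1 : (-(b:ℂ) * t).re = -b * t := by simp
    have e2 : ‖|(2 * π)⁻¹|‖ = (2 * π)⁻¹ := by
      rw [Real.norm_eq_abs, abs_abs, abs_of_pos (by positivity)]
    rw [e1, e2]
    gcongr
  have h6 : (2 * π)⁻¹ * (Real.exp (-b * t) * (K * π * Real.exp (a * t))) =
      (K / 2 * Real.exp (a * t)) * Real.exp (-b * t) := by
    field_simp
  rw [h6] at h5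
  exact le_of_mul_le_mul_right h5 (Real.exp_pos _)

/-- Summatory function in the logarithmic variable. -/
def sumFn (b : ℕ → ℝ) (t : ℝ) : ℝ := ∑ k ∈ Finset.Icc 1 ⌊Real.exp t⌋₊, b k

/-- Density of the main term. -/
def densFn (A ρ : ℝ) (t : ℝ) : ℝ := if t < 0 then 0 else A * Real.exp (ρ * t)

lemma M1.summable {b : ℕ → ℝ} (hb : ∀ k, 0 ≤ b k) {ρ C₀ A : ℝ} {Dc : ℂ → ℂ}
    (h1 : M1 b ρ C₀ A Dc) {c : ℝ} (hc : ρ < c) :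
    Summable (fun k : ℕ => b (k + 1) * ((k + 1 : ℕ) : ℝ) ^ (-c)) := by
  have h := (h1.2.2.2.2.1 (c : ℂ) (by simpa using hc)).summable.norm
  refine h.congr fun k => ?_
  rw [norm_mul, Complex.norm_real, Real.norm_of_nonneg (hb _),
    Complex.norm_natCast_cpow_of_pos (Nat.succ_pos k)]
  simp

lemma M1.partial_le {b : ℕ → ℝ} (hb : ∀ k, 0 ≤ b k) {ρ C₀ A : ℝ} {Dc : ℂ → ℂ}
    (h1 : M1 b ρ C₀ A Dc) {c : ℝ} (hc : ρ < c) :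
    ∃ C, 0 ≤ C ∧ ∀ n : ℕ, ∑ k ∈ Finset.Icc 1 n, b k ≤ C * (n : ℝ) ^ c := by
  have hc0 : 0 < c := h1.1.trans hc
  have hs := h1.summable hb hc
  refine ⟨∑' k : ℕ, b (k + 1) * ((k + 1 : ℕ) : ℝ) ^ (-c),
    tsum_nonneg fun k => mul_nonneg (hb _) (by positivity), fun n => ?_⟩
  have e1 : ∑ k ∈ Finset.Icc 1 n, b k = ∑ k ∈ Finset.range n, b (k + 1) := by
    rw [Finset.range_eq_Ico, Finset.sum_Ico_add' b 0 n 1]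
    rfl
  rw [e1]
  calc ∑ k ∈ Finset.range n, b (k + 1)
      ≤ ∑ k ∈ Finset.range n, b (k + 1) * ((k + 1 : ℕ) : ℝ) ^ (-c) * (n : ℝ) ^ c := by
        apply Finset.sum_le_sum
        intro k hk
        have hk' : k + 1 ≤ n := by simpa using hk
        have hp : (0:ℝ) < ((k + 1 : ℕ) : ℝ) := by positivity
        have : 1 ≤ ((k + 1 : ℕ) : ℝ) ^ (-c) * (n : ℝ) ^ c := by
          rw [Real.rpow_neg hp.le, inv_mul_eq_div, one_le_div (by positivity)]
          exact Real.rpow_le_rpow hp.le (by exact_mod_cast hk') hc0.le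
        rw [mul_assoc]
        exact le_mul_of_one_le_right (hb _) this
    _ = (∑ k ∈ Finset.range n, b (k + 1) * ((k + 1 : ℕ) : ℝ) ^ (-c)) * (n : ℝ) ^ c := by
        rw [Finset.sum_mul]
    _ ≤ _ := by
        gcongr
        exact hs.sum_le_tsum _ (fun k _ => mul_nonneg (hb _) (by positivity))

lemma sumFn_nice {b : ℕ → ℝ} (hb : ∀ k, 0 ≤ b k) {ρ C₀ A : ℝ} {Dc : ℂ → ℂ}
    (h1 : M1 b ρ C₀ A Dc) {c : ℝ} (hc : ρ < c) : NiceFn c (sumFn b) := by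
  have hc0 : 0 < c := h1.1.trans hc
  refine ⟨fun s t hst => ?_, fun t ht => ?_, ?_⟩
  · unfold sumFn
    apply Finset.sum_le_sum_of_subset_of_nonneg
    · apply Finset.Icc_subset_Icc_right
      exact Nat.floor_mono (Real.exp_le_exp.2 hst)
    · intro i _ _; exact hb i
  · unfold sumFn
    rw [Nat.floor_eq_zero.2 (by rw [← Real.exp_zero]; exact Real.exp_lt_exp.2 ht)]
    simp
  · obtain ⟨C, hC, h⟩ := h1.partial_le hb hc
    refine ⟨C, hC, fun t => (h _).trans ?_⟩
    gcongr
    rw [mul_comm, Real.exp_mul]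
    exact Real.rpow_le_rpow (by positivity) (Nat.floor_le (Real.exp_pos t).le) hc0.le

lemma lap_sumFn {b : ℕ → ℝ} (hb : ∀ k, 0 ≤ b k) {ρ C₀ A : ℝ} {Dc : ℂ → ℂ}
    (h1 : M1 b ρ C₀ A Dc) {s : ℂ} (hs : ρ < s.re) : lapFn (sumFn b) s = Dc s / s := by
  obtain ⟨c, hc1, hc2⟩ := exists_between hs
  have hc0 : 0 < c := h1.1.trans hc1
  have hs0 : s ≠ 0 := by rintro rfl; simp at hs; linarith [h1.1]
  obtain ⟨C, hC, hp⟩ := h1.partial_le hb hc1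
  have hO : (fun n : ℕ => ∑ k ∈ Finset.Icc 1 n, b k) =O[atTop] fun n : ℕ => (n : ℝ) ^ c := by
    apply IsBigO.of_bound C
    refine Eventually.of_forall fun n => ?_
    rw [Real.norm_of_nonneg (Finset.sum_nonneg fun i _ => hb i),
      Real.norm_of_nonneg (by positivity)]
    exact hp n
  have hL := LSeries_eq_mul_integral_of_nonneg b hc0.le hc2 hO hb
  have hD : LSeries (fun n => (b n : ℂ)) s = Dc s := by
    have hs1 := h1.2.2.2.2.1 s hs
    have hs2 : HasSum (LSeries.term (fun n => (b n : ℂ)) s) (Dc s) := by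
      rw [← hasSum_nat_add_iff' 1]
      simp only [Finset.range_one, Finset.sum_singleton, LSeries.term_zero, sub_zero]
      refine hs1.congr_fun ?_ |> fun h => h
      intro k
      rw [LSeries.term_of_ne_zero (Nat.succ_ne_zero k), Complex.cpow_neg, div_eq_mul_inv]
    exact hs2.tsum_eq
  rw [hD] at hL
  have hcv : ∫ t in Set.Ioi (1 : ℝ), (∑ k ∈ Finset.Icc 1 ⌊t⌋₊, (b k : ℂ)) * (t : ℂ) ^ (-(s + 1)) =
      lapFn (sumFn b) s := by
    have him : Real.exp '' Set.Ioi 0 = Set.Ioi 1 := by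
      ext x
      constructor
      · rintro ⟨y, hy, rfl⟩
        exact Real.one_lt_exp_iff.2 hy
      · intro hx
        have hx' : (1:ℝ) < x := hx
        exact ⟨Real.log x, Real.log_pos hx', Real.exp_log (by linarith)⟩
    rw [← him, MeasureTheory.integral_image_eq_integral_abs_deriv_smul measurableSet_Ioi
      (fun x _ => (Real.hasDerivAt_exp x).hasDerivWithinAt) Real.exp_injective.injOn]
    unfold lapFn
    apply setIntegral_congr_fun measurableSet_Ioi
    intro x _
    simp only [sumFn, abs_of_pos (Real.exp_pos x), Complex.real_smul]
    rw [Complex.cpow_def_of_ne_zero (by exact_mod_cast (Real.exp_pos x).ne'),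
      ← Complex.ofReal_log (Real.exp_pos x).le, Real.log_exp, Complex.ofReal_exp, mul_left_comm,
      ← Complex.exp_add]
    push_cast
    congr 2
    ring
  rw [hcv] at hL
  rw [hL]; field_simp

lemma densFn_nice {A ρ c : ℝ} (hA : 0 ≤ A) (hρ : 0 < ρ) (hc : ρ ≤ c) : NiceFn c (densFn A ρ) := by
  refine ⟨fun s t hst => ?_, fun t ht => by simp [densFn, ht], A, hA, fun t => ?_⟩
  · unfold densFn
    split_ifs with h1 h2 h2
    · exact le_rfl
    · positivity
    · linarith
    · gcongr
  · unfold densFn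
    split_ifs with h1
    · positivity
    · push Not at h1; gcongr

lemma lap_densFn {A ρ : ℝ} {s : ℂ} (hs : ρ < s.re) :
    lapFn (densFn A ρ) s = A / (s - ρ) := by
  unfold lapFn
  have h := integral_exp_mul_complex_Ioi (a := (ρ:ℂ) - s) (by simpa using hs) 0
  have hne : s - ρ ≠ 0 := by
    intro h0; have := congrArg Complex.re h0; simp at this; linarith
  have hne' : (ρ:ℂ) - s ≠ 0 := by
    intro h0; apply hne; rw [← neg_sub, h0, neg_zero]
  rw [setIntegral_congr_fun (g := fun x : ℝ => (A:ℂ) * Complex.exp (((ρ:ℂ) - s) * x))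
    measurableSet_Ioi, integral_const_mul, h]
  · simp only [Complex.ofReal_zero, mul_zero, Complex.exp_zero]
    rw [← neg_sub s (ρ:ℂ), neg_div_neg_eq]; ring
  · intro x hx
    have hx' : ¬ x < 0 := not_lt.2 (le_of_lt hx)
    simp only [densFn, if_neg hx']
    push_cast
    rw [mul_assoc, ← Complex.exp_add]
    congr 2; ring

lemma prim_densFn {A ρ : ℝ} (hρ : 0 < ρ) {t : ℝ} (ht : 0 ≤ t) :
    primFn (densFn A ρ) t = A * (Real.exp (ρ * t) - 1) / ρ := by
  unfold primFn
  rw [intervalIntegral.integral_congr (g := fun u => A * Real.exp (ρ * u))]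
  · rw [intervalIntegral.integral_const_mul, intervalIntegral.integral_comp_mul_left _ hρ.ne']
    simp; ring
  · intro x hx
    rw [Set.uIcc_of_le ht] at hx
    simp [densFn, not_lt.2 hx.1]

lemma kernel_bound {ρ C₀ A C₁ : ℝ} {Dc φ : ℂ → ℂ} (hρ : 0 < ρ) (hC₀ : 0 < C₀) (hA : 0 < A)
    (h2 : M2 C₀ C₁ Dc)
    (hφd : ∀ s : ℂ, -C₀ ≤ s.re → DifferentiableAt ℂ φ s)
    (hφ : ∀ s : ℂ, -C₀ ≤ s.re → s ≠ (ρ : ℂ) → Dc s = (A : ℂ) / (s - (ρ : ℂ)) + φ s) :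
    ∃ (N : ℕ) (K : ℝ), 1 ≤ N ∧ 0 ≤ K ∧ ∀ s : ℂ, ρ / 2 ≤ s.re → s.re ≤ ρ + 1 →
      ‖φ s / s ^ (N + 1)‖ ≤ K * (1 + s.im ^ 2)⁻¹ := by
  obtain ⟨hC₁, K, y₀, hK⟩ := h2
  obtain ⟨N, hN⟩ := exists_nat_ge (C₁ + 1)
  have hN1 : 1 ≤ N := by
    have : (1:ℝ) ≤ N := by linarith
    exact_mod_cast this
  set Y := max y₀ 1 with hY
  have hY1 : 1 ≤ Y := le_max_right _ _
  set S : Set ℂ := (Set.Icc (ρ / 2) (ρ + 1)) ×ℂ (Set.Icc (-Y) Y) with hS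
  have hScomp : IsCompact S := isCompact_Icc.reProdIm isCompact_Icc
  have hcont : ContinuousOn (fun s : ℂ => φ s / s ^ (N + 1)) S := by
    intro s hs
    have hre : ρ / 2 ≤ s.re := hs.1.1
    have hs0 : s ≠ 0 := by rintro rfl; simp at hre; linarith
    have := (hφd s (by linarith)).continuousAt
    apply ContinuousAt.continuousWithinAt
    exact this.div (by fun_prop) (pow_ne_zero _ hs0)
  obtain ⟨K₂, hK₂⟩ := hScomp.exists_bound_of_continuousOn hcont
  refine ⟨N, max 0 (max (2 * (|K| + A)) (K₂ * (1 + Y ^ 2))), hN1, le_max_left _ _,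
    fun s hs1 hs2 => ?_⟩
  have hpos : 0 < 1 + s.im ^ 2 := by positivity
  rw [← div_eq_mul_inv, le_div_iff₀ hpos]
  rcases le_total |s.im| Y with hy | hy
  · refine le_trans ?_ ((le_max_right _ _).trans (le_max_right _ _))
    have h3 := hK₂ s ⟨⟨hs1, hs2⟩, abs_le.1 hy⟩
    have : s.im ^ 2 ≤ Y ^ 2 := by
      rw [← sq_abs]; gcongr
    have h0 : 0 ≤ K₂ := (norm_nonneg _).trans h3
    gcongr
  · refine le_trans ?_ ((le_max_left _ _).trans (le_max_right _ _))
    have hy1 : 1 ≤ |s.im| := hY1.trans hy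
    have hy0 : 0 < |s.im| := by linarith
    have hsρ : s ≠ (ρ : ℂ) := by
      rintro rfl; simp at hy1; linarith
    have e1 : φ s = Dc s - A / (s - ρ) := by
      rw [hφ s (by linarith) hsρ]; ring
    have e2 : ‖(A:ℂ) / (s - ρ)‖ ≤ A := by
      rw [norm_div, Complex.norm_real, Real.norm_of_nonneg hA.le]
      apply div_le_self hA.le
      refine hy1.trans ?_
      simpa using Complex.abs_im_le_norm (s - ρ)
    have e3 : ‖φ s‖ ≤ (|K| + A) * |s.im| ^ C₁ := by
      rw [e1]
      refine (norm_sub_le _ _).trans ?_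
      have h3 := hK s (by linarith) ((le_max_left _ _).trans hy)
      have h4 : 1 ≤ |s.im| ^ C₁ := Real.one_le_rpow hy1 hC₁.le
      have h5 : K * |s.im| ^ C₁ ≤ |K| * |s.im| ^ C₁ := by gcongr; exact le_abs_self K
      nlinarith
    have e4 : |s.im| ^ C₁ * |s.im| ^ 2 ≤ ‖s ^ (N + 1)‖ := by
      rw [norm_pow]
      calc |s.im| ^ C₁ * |s.im| ^ 2 = |s.im| ^ (C₁ + 2) := by
            rw [Real.rpow_add hy0]; norm_num
        _ ≤ |s.im| ^ ((N + 1 : ℕ) : ℝ) := by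
            apply Real.rpow_le_rpow_of_exponent_le hy1
            push_cast; linarith
        _ = |s.im| ^ (N + 1) := Real.rpow_natCast _ _
        _ ≤ _ := by gcongr; exact Complex.abs_im_le_norm s
    have hp : 0 < |s.im| ^ C₁ := by positivity
    have e5 : 0 < ‖s ^ (N + 1)‖ := lt_of_lt_of_le (by positivity) e4
    rw [norm_div, div_mul_eq_mul_div, div_le_iff₀ e5]
    have e6 : 1 + s.im ^ 2 ≤ 2 * |s.im| ^ 2 := by
      rw [← sq_abs s.im]; nlinarith
    have hKA : 0 ≤ |K| + A := by positivity
    calc ‖φ s‖ * (1 + s.im ^ 2) ≤ ((|K| + A) * |s.im| ^ C₁) * (2 * |s.im| ^ 2) := by gcongr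
      _ = 2 * (|K| + A) * (|s.im| ^ C₁ * |s.im| ^ 2) := by ring
      _ ≤ _ := by gcongr

lemma landau_log {b : ℕ → ℝ} (hb : ∀ k, 0 ≤ b k) {ρ C₀ A C₁ : ℝ} {Dc : ℂ → ℂ}
    (h1 : M1 b ρ C₀ A Dc) (h2 : M2 C₀ C₁ Dc) :
    ∃ δ, 0 < δ ∧ δ ≤ ρ ∧ ∃ C, 0 ≤ C ∧
      ∀ t, |sumFn b t - primFn (densFn A ρ) t| ≤ C * Real.exp ((ρ - δ) * t) := by
  obtain ⟨hρ, hC₀, -, hA, hsum, -, φ, hφd, hφ⟩ := id h1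
  obtain ⟨N, K, hN1, hK0, hK⟩ := kernel_bound hρ hC₀ hA h2 hφd hφ
  have hc : ρ < ρ + 1 / 2 := by linarith
  have hc0 : 0 < ρ + 1 / 2 := by linarith
  have hE : NiceFn (ρ + 1 / 2) (sumFn b) := sumFn_nice hb h1 hc
  have hf : NiceFn (ρ + 1 / 2) (densFn A ρ) := densFn_nice hA.le hρ hc.le
  have hEN := hE.iter hc0 N
  have hMN := (hf.prim hc0).iter hc0 N
  refine tauber_iter hc0 hρ hE (densFn_nice hA.le hρ le_rfl) N (ρ / 2) (by linarith) (by linarith)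
    (K / 2) (by linarith) ?_
  intro t
  have hρ2 : ρ - ρ / 2 = ρ / 2 := by ring
  rw [hρ2]
  have hcontIter : ∀ {g : ℝ → ℝ}, NiceFn (ρ + 1 / 2) g → Continuous (primFn^[N] g) ∧
      ∀ t ≤ 0, primFn^[N] g t = 0 := by
    intro g hg
    obtain ⟨n, rfl⟩ := Nat.exists_eq_succ_of_ne_zero (by omega : N ≠ 0)
    rw [Function.iterate_succ']
    exact ⟨(hg.iter hc0 n).prim_cont, fun t ht => (hg.iter hc0 n).prim_neg ht⟩
  have hIntg : ∀ s : ℂ, ρ + 1 / 2 < s.re →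
      IntegrableOn (fun t : ℝ => ((primFn^[N] (sumFn b) t - primFn^[N] (primFn (densFn A ρ)) t : ℝ) : ℂ)
        * Complex.exp (-s * t)) (Set.Ioi 0) := by
    intro s hs
    refine ((hEN.integrable_lap hs).sub (hMN.integrable_lap hs)).congr_fun ?_ measurableSet_Ioi
    intro x _
    simp only [Pi.sub_apply]; push_cast; ring
  have := laplace_inv_bound (fun t => primFn^[N] (sumFn b) t - primFn^[N] (primFn (densFn A ρ)) t)
    (fun s => φ s / s ^ (N + 1)) (a := ρ / 2) (b := ρ + 1) (K := K) (by linarith)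
    ((hcontIter hE).1.sub (hcontIter (hf.prim hc0)).1)
    (fun t ht => by
      simp only [(hcontIter hE).2 t ht, (hcontIter (hf.prim hc0)).2 t ht, sub_zero])
    (hIntg _ (by simp; linarith)) ?_ ?_ hK t
  · exact this
  · intro s hs
    have hs1 : ρ + 1 / 2 < s.re := by linarith
    have hs0 : s ≠ 0 := by rintro rfl; simp at hs; linarith
    have hsρ : s ≠ ρ := by rintro rfl; simp at hs
    have e1 := hE.lap_iter hc0 N hs1
    have e2 := (hf.prim hc0).lap_iter hc0 N hs1
    rw [lap_sumFn hb h1 (by linarith)] at e1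
    rw [hf.lap_prim hc0 hs1, lap_densFn (by linarith)] at e2
    have e3 : lapFn (fun t => primFn^[N] (sumFn b) t - primFn^[N] (primFn (densFn A ρ)) t) s =
        lapFn (primFn^[N] (sumFn b)) s - lapFn (primFn^[N] (primFn (densFn A ρ))) s := by
      unfold lapFn
      rw [← integral_sub (hEN.integrable_lap hs1) (hMN.integrable_lap hs1)]
      apply setIntegral_congr_fun measurableSet_Ioi
      intro x _
      push_cast; ring
    rw [e3, e1, e2, hφ s (by linarith) hsρ]
    field_simp
    ring
  · intro s h3 h4
    have hs0 : s ≠ 0 := by rintro rfl; simp at h3; linarith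
    exact (hφd s (by linarith)).div (by fun_prop) (pow_ne_zero _ hs0)

lemma landau {b : ℕ → ℝ} (hb : ∀ k, 0 ≤ b k) {ρ C₀ A C₁ : ℝ} {Dc : ℂ → ℂ}
    (h1 : M1 b ρ C₀ A Dc) (h2 : M2 C₀ C₁ Dc) :
    ∃ κ C : ℝ, 0 ≤ κ ∧ κ < ρ ∧ ρ - 1 ≤ κ ∧ 0 ≤ C ∧ ∀ x : ℝ, 1 ≤ x →
      |∑ k ∈ Finset.Icc 1 ⌊x⌋₊, b k - A * (x ^ ρ - 1) / ρ| ≤ C * x ^ κ := by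
  obtain ⟨δ, hδ, hδρ, C, hC, h⟩ := landau_log hb h1 h2
  have hρ := h1.1
  refine ⟨max (ρ - δ) (ρ - 1), C, (by linarith : 0 ≤ ρ - δ).trans (le_max_left _ _),
    max_lt (by linarith) (by linarith), le_max_right _ _, hC, fun x hx => ?_⟩
  have hx0 : 0 < x := by linarith
  have := h (Real.log x)
  rw [sumFn, prim_densFn hρ (Real.log_nonneg hx), Real.exp_log hx0, mul_comm ρ, mul_comm (ρ - δ),
    ← Real.rpow_def_of_pos hx0, ← Real.rpow_def_of_pos hx0] at this
  refine this.trans ?_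
  gcongr
  exact le_max_left _ _

lemma landau0 {b : ℕ → ℝ} (hb : ∀ k, 0 ≤ b k) {ρ C₀ A C₁ : ℝ} {Dc : ℂ → ℂ}
    (h1 : M1 b ρ C₀ A Dc) (h2 : M2 C₀ C₁ Dc) :
    ∃ κ C : ℝ, 0 ≤ κ ∧ κ < ρ ∧ ρ - 1 ≤ κ ∧ 0 ≤ C ∧ ∀ x : ℝ, 1 ≤ x →
      |∑ k ∈ Finset.Icc 0 ⌊x⌋₊, b k - A * x ^ ρ / ρ| ≤ C * x ^ κ := by
  obtain ⟨κ, C, h3, h4, h5, hC, h⟩ := landau hb h1 h2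
  have hρ := h1.1
  have hA := h1.2.2.2.1
  have hb0 := hb 0
  refine ⟨κ, C + b 0 + A / ρ, h3, h4, h5, by positivity, fun x hx => ?_⟩
  have e : ∑ k ∈ Finset.Icc 0 ⌊x⌋₊, b k = b 0 + ∑ k ∈ Finset.Icc 1 ⌊x⌋₊, b k := by
    rw [← Finset.insert_Icc_add_one_left_eq_Icc (Nat.zero_le _), Finset.sum_insert (by simp)]
    rfl
  have e2 : ∑ k ∈ Finset.Icc 0 ⌊x⌋₊, b k - A * x ^ ρ / ρ =
      (∑ k ∈ Finset.Icc 1 ⌊x⌋₊, b k - A * (x ^ ρ - 1) / ρ) + (b 0 - A / ρ) := by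
    rw [e]; ring
  rw [e2]
  refine (abs_add_le _ _).trans ?_
  have h6 := h x hx
  have h7 : |b 0 - A / ρ| ≤ b 0 + A / ρ := by
    refine (abs_sub _ _).trans ?_
    rw [abs_of_nonneg hb0, abs_of_nonneg (by positivity)]
  have h8 : 1 ≤ x ^ κ := Real.one_le_rpow hx h3
  have h9 : 0 ≤ b 0 + A / ρ := by positivity
  nlinarith

lemma rpow_le_exp_mul {κ ε : ℝ} (hκ : 0 ≤ κ) (hε : 0 < ε) :
    ∃ C : ℝ, 0 < C ∧ ∀ y : ℝ, 0 ≤ y → y ^ κ ≤ C * Real.exp (ε * y) := by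
  obtain ⟨n, hn⟩ := exists_nat_ge κ
  refine ⟨1 + n.factorial / ε ^ n, by positivity, fun y hy => ?_⟩
  have h1 : y ^ κ ≤ 1 + y ^ n := by
    rcases le_total y 1 with h | h
    · have : y ^ κ ≤ 1 := Real.rpow_le_one hy h hκ
      have : 0 ≤ y ^ n := by positivity
      linarith
    · have : y ^ κ ≤ y ^ (n:ℝ) := Real.rpow_le_rpow_of_exponent_le h hn
      rw [Real.rpow_natCast] at this
      linarith
  have h2 := Real.pow_div_factorial_le_exp (ε * y) (by positivity) n
  have h3 : y ^ n ≤ n.factorial / ε ^ n * Real.exp (ε * y) := by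
    rw [div_le_iff₀ (by positivity), mul_pow] at h2
    rw [div_mul_eq_mul_div, le_div_iff₀ (by positivity)]
    linarith
  have h4 : 1 ≤ Real.exp (ε * y) := Real.one_le_exp (by positivity)
  linarith

/-- The function `log (1 - e^{-αx})`. -/
def gFn (α x : ℝ) : ℝ := Real.log (1 - Real.exp (-(x * α)))

/-- Its derivative. -/
def gFn' (α x : ℝ) : ℝ := α * Real.exp (-(x * α)) / (1 - Real.exp (-(x * α)))

lemma one_sub_exp_pos {y : ℝ} (hy : 0 < y) : 0 < 1 - Real.exp (-y) := by
  have : Real.exp (-y) < 1 := by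
    rw [← Real.exp_zero]; exact Real.exp_lt_exp.2 (by linarith)
  linarith

lemma half_le_one_sub_exp {y : ℝ} (hy : 1 ≤ y) : 1 / 2 ≤ 1 - Real.exp (-y) := by
  have h1 : Real.exp (-y) ≤ Real.exp (-1) := Real.exp_le_exp.2 (by linarith)
  have h2 : Real.exp (-1) ≤ 1 / 2 := by
    rw [Real.exp_neg, inv_le_comm₀ (Real.exp_pos _) (by norm_num)]
    have := Real.add_one_le_exp (1:ℝ)
    norm_num at this ⊢; linarith
  linarith

lemma hasDerivAt_gFn {α x : ℝ} (hα : 0 < α) (hx : 0 < x) : HasDerivAt (gFn α) (gFn' α x) x := by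
  have h0 : 0 < 1 - Real.exp (-(x * α)) := one_sub_exp_pos (by positivity)
  have h1 : HasDerivAt (fun x : ℝ => -(x * α)) (-α) x := by
    simpa using ((hasDerivAt_id x).mul_const α).fun_neg
  have h2 := (h1.exp.const_sub 1).log h0.ne'
  refine h2.congr_deriv ?_
  unfold gFn'
  ring

lemma abs_log_one_sub_le {y : ℝ} (h0 : 0 ≤ y) (h1 : y < 1) : |Real.log (1 - y)| ≤ y / (1 - y) := by
  have hp : 0 < 1 - y := by linarith
  rw [abs_of_nonpos (Real.log_nonpos hp.le (by linarith))]
  have := Real.one_sub_inv_le_log_of_pos hp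
  have e : y / (1 - y) = (1 - y)⁻¹ - 1 := by field_simp; ring
  rw [e]; linarith

lemma abs_gFn_le {α x : ℝ} (h : 1 ≤ x * α) : |gFn α x| ≤ 2 * Real.exp (-(x * α)) := by
  have h1 := half_le_one_sub_exp h
  refine (abs_log_one_sub_le (Real.exp_pos _).le (by linarith)).trans ?_
  rw [div_le_iff₀ (by linarith)]
  nlinarith [Real.exp_pos (-(x * α))]

lemma gFn'_nonneg {α x : ℝ} (hα : 0 < α) (h : 1 ≤ x * α) : 0 ≤ gFn' α x := by
  have h1 := half_le_one_sub_exp h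
  unfold gFn'
  apply div_nonneg (by positivity) (by linarith)

lemma gFn'_le {α x : ℝ} (hα : 0 < α) (h : 1 ≤ x * α) :
    gFn' α x ≤ 2 * α * Real.exp (-(x * α)) := by
  have h1 := half_le_one_sub_exp h
  unfold gFn'
  rw [div_le_iff₀ (by linarith)]
  nlinarith [mul_pos hα (Real.exp_pos (-(x * α)))]

lemma weight_le {κ q D α x : ℝ} (hα : 0 < α) (hx : 0 ≤ x)
    (hD : ∀ y : ℝ, 0 ≤ y → y ^ κ ≤ D * Real.exp ((1 - q) * y)) :
    x ^ κ * Real.exp (-(x * α)) ≤ D * α ^ (-κ) * Real.exp (-(q * α) * x) := by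
  have h1 := hD (x * α) (by positivity)
  rw [Real.mul_rpow hx hα.le] at h1
  have hp : 0 < α ^ κ := by positivity
  have h2 : x ^ κ ≤ D * α ^ (-κ) * Real.exp ((1 - q) * (x * α)) := by
    rw [Real.rpow_neg hα.le]
    rw [← le_div_iff₀ hp] at h1
    refine h1.trans (le_of_eq ?_)
    field_simp
  calc x ^ κ * Real.exp (-(x * α))
      ≤ D * α ^ (-κ) * Real.exp ((1 - q) * (x * α)) * Real.exp (-(x * α)) := by gcongr
    _ = _ := by rw [mul_assoc, ← Real.exp_add]; ring_nf

lemma finite_abel {b : ℕ → ℝ} {ρ A κ C q D : ℝ} (hρ : 0 < ρ) (hA : 0 < A)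
    (hκρ : ρ - 1 ≤ κ) (hC : 0 ≤ C) (hq : 0 < q) (hD0 : 0 < D)
    (hR : ∀ x : ℝ, 1 ≤ x → |∑ k ∈ Finset.Icc 0 ⌊x⌋₊, b k - A * x ^ ρ / ρ| ≤ C * x ^ κ)
    (hD : ∀ y : ℝ, 0 ≤ y → y ^ κ ≤ D * Real.exp ((1 - q) * y))
    {α : ℝ} (hα : 0 < α) {m N : ℕ} (hm : 1 ≤ m) (hmα : 1 ≤ m * α) (hmN : m + 1 ≤ N) :
    |∑ k ∈ Finset.Ioc m N, gFn α k * b k -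
      A * ∫ x in ((m:ℝ) + 1)..N, x ^ (ρ - 1) * gFn α x| ≤
      (2 * C * (2 + 1 / q) + 2 * A) * D * α ^ (-κ) * Real.exp (-(q * α) * m) := by
  have hm1 : (1:ℝ) ≤ m := by exact_mod_cast hm
  have hmN' : (m:ℝ) ≤ N := by exact_mod_cast (by omega : m ≤ N)
  have hmN1 : (m:ℝ) + 1 ≤ N := by exact_mod_cast hmN
  have hxα : ∀ x : ℝ, (m:ℝ) ≤ x → 1 ≤ x * α := fun x hx => hmα.trans (by gcongr)
  set B : ℝ → ℝ := fun x => ∑ k ∈ Finset.Icc 0 ⌊x⌋₊, b k with hB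
  set R : ℝ → ℝ := fun x => B x - A * x ^ ρ / ρ with hRdef
  set X := D * α ^ (-κ) * Real.exp (-(q * α) * m) with hX
  have hX0 : 0 ≤ X := by positivity
  have hder : ∀ t ∈ Set.Icc (m:ℝ) N, HasDerivAt (gFn α) (gFn' α t) t := fun t ht =>
    hasDerivAt_gFn hα (by linarith [ht.1])
  have hg'cont : ContinuousOn (gFn' α) (Set.Icc (m:ℝ) N) := by
    unfold gFn'
    apply ContinuousOn.div (by fun_prop) (by fun_prop)
    intro x hx
    have := half_le_one_sub_exp (hxα x hx.1)
    linarith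
  have hgcont : ContinuousOn (gFn α) (Set.Icc (m:ℝ) N) := fun x hx =>
    (hder x hx).continuousAt.continuousWithinAt
  have hrp : ∀ e : ℝ, ContinuousOn (fun x : ℝ => x ^ e) (Set.Icc (m:ℝ) N) := fun e x hx =>
    (Real.continuousAt_rpow_const x e (Or.inl (by linarith [hx.1]))).continuousWithinAt
  have hg'int : IntegrableOn (deriv (gFn α)) (Set.Icc (m:ℝ) N) :=
    (hg'cont.integrableOn_Icc).congr_fun (fun x hx => (hder x hx).deriv.symm) measurableSet_Icc
  have habel := sum_mul_eq_sub_sub_integral_mul' b (f := gFn α) (by omega : m ≤ N)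
    (fun t ht => (hder t ht).differentiableAt) hg'int
  have hBint : IntegrableOn (fun t => gFn' α t * B t) (Set.Icc (m:ℝ) N) :=
    integrableOn_mul_sum_Icc b (by linarith) hg'cont.integrableOn_Icc
  have hBii : IntervalIntegrable (fun t => gFn' α t * B t) volume m N := by
    rw [intervalIntegrable_iff_integrableOn_Icc_of_le hmN']; exact hBint
  have e1 : ∫ t in Set.Ioc (m:ℝ) N, deriv (gFn α) t * ∑ k ∈ Finset.Icc 0 ⌊t⌋₊, b k =
      ∫ t in (m:ℝ)..N, gFn' α t * B t := by
    rw [intervalIntegral.integral_of_le hmN']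
    apply setIntegral_congr_fun measurableSet_Ioc
    intro t ht
    simp only [hB, (hder t ⟨ht.1.le, ht.2⟩).deriv]
  rw [e1] at habel
  have hcI : ∀ {f : ℝ → ℝ}, ContinuousOn f (Set.Icc (m:ℝ) N) → IntervalIntegrable f volume m N := by
    intro f hf
    apply ContinuousOn.intervalIntegrable
    rwa [Set.uIcc_of_le hmN']
  -- integration by parts for the main term
  have hparts := intervalIntegral.integral_mul_deriv_eq_deriv_mul (a := (m:ℝ)) (b := N)
    (u := gFn α) (u' := gFn' α) (v := fun x => A * x ^ ρ / ρ) (v' := fun x => A * x ^ (ρ - 1))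
    (fun x hx => hder x (by rwa [Set.uIcc_of_le hmN'] at hx))
    (fun x hx => by
      rw [Set.uIcc_of_le hmN'] at hx
      have := ((Real.hasDerivAt_rpow_const (x := x) (p := ρ)
        (Or.inl (by linarith [hx.1]))).const_mul A).div_const ρ
      refine this.congr_deriv ?_
      field_simp)
    (hcI hg'cont) (hcI ((hrp _).const_mul A |>.congr fun x hx => rfl))
  have hMii : IntervalIntegrable (fun t => gFn' α t * (A * t ^ ρ / ρ)) volume m N :=
    hcI (hg'cont.mul (((hrp ρ).const_mul A).div_const ρ))
  have hid : ∑ k ∈ Finset.Ioc m N, gFn α k * b k - ∫ x in (m:ℝ)..N, gFn α x * (A * x ^ (ρ - 1)) =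
      gFn α N * R N - gFn α m * R m - ∫ t in (m:ℝ)..N, gFn' α t * R t := by
    have e2 : ∫ t in (m:ℝ)..N, gFn' α t * R t = (∫ t in (m:ℝ)..N, gFn' α t * B t) -
        ∫ t in (m:ℝ)..N, gFn' α t * (A * t ^ ρ / ρ) := by
      rw [← intervalIntegral.integral_sub hBii hMii]
      congr 1; ext t; simp only [hRdef]; ring
    rw [habel, hparts, e2]
    simp only [hRdef, hB, Nat.floor_natCast]
    ring
  have hgw : ∀ x : ℝ, (m:ℝ) ≤ x → x ^ κ * |gFn α x| ≤ 2 * D * α ^ (-κ) * Real.exp (-(q * α) * x) := by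
    intro x hx
    have h3 := abs_gFn_le (hxα x hx)
    have h4 := weight_le hα (by linarith : 0 ≤ x) hD
    have h5 : 0 ≤ x ^ κ := Real.rpow_nonneg (by linarith) _
    nlinarith [mul_le_mul_of_nonneg_left h3 h5]
  have hexpmono : ∀ x : ℝ, (m:ℝ) ≤ x → Real.exp (-(q * α) * x) ≤ Real.exp (-(q * α) * m) := by
    intro x hx
    apply Real.exp_le_exp.2
    have : 0 < q * α := by positivity
    nlinarith
  have hgw' : ∀ x : ℝ, (m:ℝ) ≤ x → x ^ κ * |gFn α x| ≤ 2 * X := by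
    intro x hx
    refine (hgw x hx).trans ?_
    have : 0 ≤ 2 * D * α ^ (-κ) := by positivity
    have := mul_le_mul_of_nonneg_left (hexpmono x hx) this
    refine this.trans (le_of_eq ?_)
    rw [hX]; ring
  have hbdry : ∀ x : ℝ, (m:ℝ) ≤ x → |gFn α x * R x| ≤ C * (2 * X) := by
    intro x hx
    rw [abs_mul]
    have h3 := hR x (by linarith)
    have h4 := hgw' x hx
    calc |gFn α x| * |R x| ≤ |gFn α x| * (C * x ^ κ) := by gcongr
      _ = C * (x ^ κ * |gFn α x|) := by ring
      _ ≤ _ := by gcongr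
  have hintb : |∫ t in (m:ℝ)..N, gFn' α t * R t| ≤ 2 * C * (1 / q) * X := by
    have h3 : ‖∫ t in (m:ℝ)..N, gFn' α t * R t‖ ≤
        ∫ t in (m:ℝ)..N, 2 * C * α * (D * α ^ (-κ)) * Real.exp (-(q * α) * t) := by
      apply intervalIntegral.norm_integral_le_of_norm_le hmN'
      · refine Eventually.of_forall fun t ht => ?_
        have ht1 : (m:ℝ) ≤ t := ht.1.le
        rw [Real.norm_eq_abs, abs_mul, abs_of_nonneg (gFn'_nonneg hα (hxα t ht1))]
        have h4 := gFn'_le hα (hxα t ht1)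
        have h5 := hR t (by linarith)
        have h6 := weight_le hα (by linarith : 0 ≤ t) hD
        have h7 : 0 ≤ t ^ κ := Real.rpow_nonneg (by linarith) _
        calc gFn' α t * |R t| ≤ (2 * α * Real.exp (-(t * α))) * (C * t ^ κ) := by gcongr
          _ = 2 * C * α * (t ^ κ * Real.exp (-(t * α))) := by ring
          _ ≤ 2 * C * α * (D * α ^ (-κ) * Real.exp (-(q * α) * t)) := by gcongr
          _ = _ := by ring
      · apply Continuous.intervalIntegrable; fun_prop
    have hqα : -(q * α) ≠ 0 := by
      have : 0 < q * α := by positivity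
      linarith
    rw [intervalIntegral.integral_const_mul, intervalIntegral.integral_comp_mul_left _ hqα,
      integral_exp, Real.norm_eq_abs] at h3
    refine h3.trans ?_
    have h4 : 0 < Real.exp (-(q * α) * N) := Real.exp_pos _
    have h5 : 2 * C * α * (D * α ^ (-κ)) * ((-(q * α))⁻¹ •
        (Real.exp (-(q * α) * N) - Real.exp (-(q * α) * m))) =
        2 * C * (1 / q) * (D * α ^ (-κ)) * (Real.exp (-(q * α) * m) - Real.exp (-(q * α) * N)) := by
      rw [smul_eq_mul]; field_simp; ring
    rw [h5]
    have h6 : 0 ≤ 2 * C * (1 / q) * (D * α ^ (-κ)) := by positivity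
    rw [hX]
    nlinarith
  have hfirst : |∫ x in (m:ℝ)..(m + 1), gFn α x * (A * x ^ (ρ - 1))| ≤ 2 * A * X := by
    have := intervalIntegral.norm_integral_le_of_norm_le_const (a := (m:ℝ)) (b := m + 1)
      (f := fun x => gFn α x * (A * x ^ (ρ - 1))) (C := 2 * A * X) (by
        intro x hx
        rw [Set.uIoc_of_le (by linarith)] at hx
        have hx1 : (m:ℝ) ≤ x := hx.1.le
        have h4 := hgw' x hx1
        have h5 : x ^ (ρ - 1) ≤ x ^ κ := Real.rpow_le_rpow_of_exponent_le (by linarith) hκρ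
        have h6 : 0 ≤ x ^ (ρ - 1) := Real.rpow_nonneg (by linarith) _
        rw [Real.norm_eq_abs, abs_mul, abs_mul, abs_of_pos hA, abs_of_nonneg h6]
        calc |gFn α x| * (A * x ^ (ρ - 1)) ≤ |gFn α x| * (A * x ^ κ) := by gcongr
          _ = A * (x ^ κ * |gFn α x|) := by ring
          _ ≤ A * (2 * X) := by gcongr
          _ = _ := by ring)
    simpa using this
  have hsplit : (∫ x in (m:ℝ)..(m + 1), gFn α x * (A * x ^ (ρ - 1))) +
      (∫ x in ((m:ℝ) + 1)..N, gFn α x * (A * x ^ (ρ - 1))) =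
      ∫ x in (m:ℝ)..N, gFn α x * (A * x ^ (ρ - 1)) := by
    have hc : ContinuousOn (fun x => gFn α x * (A * x ^ (ρ - 1))) (Set.Icc (m:ℝ) N) :=
      hgcont.mul ((hrp _).const_mul A |>.congr fun x hx => rfl)
    apply intervalIntegral.integral_add_adjacent_intervals
    · apply ContinuousOn.intervalIntegrable
      rw [Set.uIcc_of_le (by linarith)]
      exact hc.mono (Set.Icc_subset_Icc le_rfl hmN1)
    · apply ContinuousOn.intervalIntegrable
      rw [Set.uIcc_of_le hmN1]
      exact hc.mono (Set.Icc_subset_Icc (by linarith) le_rfl)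
  have hAint : A * ∫ x in ((m:ℝ) + 1)..N, x ^ (ρ - 1) * gFn α x =
      ∫ x in ((m:ℝ) + 1)..N, gFn α x * (A * x ^ (ρ - 1)) := by
    rw [← intervalIntegral.integral_const_mul]
    congr 1; ext x; ring
  rw [hAint]
  have hfin : ∑ k ∈ Finset.Ioc m N, gFn α k * b k -
      ∫ x in ((m:ℝ) + 1)..N, gFn α x * (A * x ^ (ρ - 1)) =
      (gFn α N * R N - gFn α m * R m - ∫ t in (m:ℝ)..N, gFn' α t * R t) +
      ∫ x in (m:ℝ)..(m + 1), gFn α x * (A * x ^ (ρ - 1)) := by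
    rw [← hid, ← hsplit]; ring
  rw [hfin]
  have b1 := abs_le.1 (hbdry N hmN')
  have b2 := abs_le.1 (hbdry m le_rfl)
  have b3 := abs_le.1 hintb
  have b4 := abs_le.1 hfirst
  have etot : (2 * C * (2 + 1 / q) + 2 * A) * D * α ^ (-κ) * Real.exp (-(q * α) * m) =
      C * (2 * X) + C * (2 * X) + 2 * C * (1 / q) * X + 2 * A * X := by
    rw [hX]; ring
  rw [etot, abs_le]
  constructor <;> linarith [b1.1, b1.2, b2.1, b2.2, b3.1, b3.2, b4.1, b4.2]

lemma M1.summable_geom {b : ℕ → ℝ} (hb : ∀ k, 0 ≤ b k) {ρ C₀ A : ℝ} {Dc : ℂ → ℂ}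
    (h1 : M1 b ρ C₀ A Dc) {r : ℝ} (hr0 : 0 < r) (hr1 : r < 1) :
    Summable (fun k : ℕ => b (k + 1) * ((k:ℝ) + 1) * r ^ k) := by
  obtain ⟨C, hC, hle⟩ := h1.partial_le hb (c := ρ + 1) (by linarith)
  obtain ⟨n, hn⟩ := exists_nat_ge (ρ + 1)
  have hs := summable_pow_mul_geometric_of_norm_lt_one (R := ℝ) (n + 1) (r := r)
    (by rwa [Real.norm_eq_abs, abs_of_pos hr0])
  have hs2 := ((summable_nat_add_iff 1).2 hs).mul_left (C / r)
  refine Summable.of_nonneg_of_le (fun k => ?_) (fun k => ?_) hs2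
  · have := hb (k + 1); positivity
  · have h3 : b (k + 1) ≤ C * ((k:ℝ) + 1) ^ n := by
      have h4 : b (k + 1) ≤ ∑ j ∈ Finset.Icc 1 (k + 1), b j :=
        Finset.single_le_sum (f := b) (fun i _ => hb i) (by simp)
      have h5 := hle (k + 1)
      have h6 : (((k + 1 : ℕ) : ℝ)) ^ (ρ + 1) ≤ ((k:ℝ) + 1) ^ (n:ℝ) := by
        push_cast
        exact Real.rpow_le_rpow_of_exponent_le (by linarith [(Nat.cast_nonneg k : (0:ℝ) ≤ k)]) hn
      rw [Real.rpow_natCast] at h6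
      exact h4.trans (h5.trans (by gcongr))
    calc b (k + 1) * ((k:ℝ) + 1) * r ^ k ≤ (C * ((k:ℝ) + 1) ^ n) * ((k:ℝ) + 1) * r ^ k := by gcongr
      _ = _ := by push_cast; field_simp; ring

lemma M1.summable_log {b : ℕ → ℝ} (hb : ∀ k, 0 ≤ b k) {ρ C₀ A : ℝ} {Dc : ℂ → ℂ}
    (h1 : M1 b ρ C₀ A Dc) {r : ℝ} (hr0 : 0 < r) (hr1 : r < 1) :
    Summable (fun k : ℕ => b (k + 1) * Real.log (1 - r ^ (k + 1))) := by
  refine Summable.of_norm_bounded ((h1.summable_geom hb hr0 hr1).mul_left (1 / (1 - r))) fun k => ?_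
  have hbk := hb (k + 1)
  have hrk : r ^ (k + 1) ≤ r := by
    rw [pow_succ]
    have := pow_le_one₀ hr0.le hr1.le (n := k)
    nlinarith
  have hrk0 : 0 < r ^ k := by positivity
  have h3 := abs_log_one_sub_le (y := r ^ (k + 1)) (by positivity) (by linarith)
  have h1r : 0 < 1 - r := by linarith
  have h4 : r ^ (k + 1) / (1 - r ^ (k + 1)) ≤ (1 / (1 - r)) * (((k:ℝ) + 1) * r ^ k) := by
    have h5 : r ^ (k + 1) ≤ ((k:ℝ) + 1) * r ^ k := by
      rw [pow_succ]
      have : (0:ℝ) ≤ k := Nat.cast_nonneg k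
      nlinarith
    have h6 : r ^ (k + 1) / (1 - r ^ (k + 1)) ≤ (((k:ℝ) + 1) * r ^ k) / (1 - r) := by
      gcongr
    refine h6.trans (le_of_eq ?_)
    ring
  rw [Real.norm_eq_abs, abs_mul, abs_of_nonneg hbk]
  calc b (k + 1) * |Real.log (1 - r ^ (k + 1))| ≤
      b (k + 1) * ((1 / (1 - r)) * (((k:ℝ) + 1) * r ^ k)) := by
        gcongr; exact h3.trans h4
    _ = _ := by ring

lemma log_term_lip {r x y : ℝ} (hr1 : r < 1) (hx : x ∈ Set.Ioo 0 r)
    (hy : y ∈ Set.Ioo 0 r) (k : ℕ) :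
    ‖Real.log (1 - y ^ (k + 1)) - Real.log (1 - x ^ (k + 1))‖ ≤
      (((k:ℝ) + 1) * r ^ k / (1 - r)) * ‖y - x‖ := by
  have hle : ∀ z ∈ Set.Ioo 0 r, z ^ (k + 1) ≤ r := by
    intro z hz
    rw [pow_succ]
    have h2 := pow_le_one₀ hz.1.le (hz.2.trans hr1).le (n := k)
    nlinarith [hz.1, hz.2]
  refine (convex_Ioo 0 r).norm_image_sub_le_of_norm_hasDerivWithin_le
    (f := fun z => Real.log (1 - z ^ (k + 1)))
    (f' := fun z => -(((k + 1 : ℕ) : ℝ) * z ^ k) / (1 - z ^ (k + 1)))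
    (fun z hz => ?_) (fun z hz => ?_) hx hy
  · have h0 : 1 - z ^ (k + 1) ≠ 0 := by
      have := hle z hz; linarith
    have := ((hasDerivAt_pow (k + 1) z).const_sub 1).log h0
    exact this.hasDerivWithinAt
  · have h0 : 0 < 1 - z ^ (k + 1) := by
      have := hle z hz; linarith
    have h1 := hle z hz
    have hz0 := hz.1
    rw [norm_div, norm_neg, Real.norm_eq_abs, Real.norm_eq_abs, abs_of_pos h0,
      abs_of_nonneg (by positivity)]
    have hz2 := hz.2.le
    have h1r : 0 < 1 - r := by linarith
    push_cast
    gcongr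
    have hr : 0 ≤ r := hz0.le.trans hz2
    positivity

lemma M1.Abf_bound {b : ℕ → ℝ} (hb : ∀ k, 0 ≤ b k) {ρ C₀ A : ℝ} {Dc : ℂ → ℂ}
    (h1 : M1 b ρ C₀ A Dc) {r : ℝ} (hr0 : 0 < r) (hr1 : r < 1) :
    ∃ L : ℝ, ∀ x ∈ Set.Ioo 0 r, |Abf b x| ≤ L := by
  have hs := (h1.summable_geom hb hr0 hr1).mul_left (1 / (1 - r))
  set L := ∑' k : ℕ, (1 / (1 - r)) * (b (k + 1) * ((k:ℝ) + 1) * r ^ k) with hL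
  have h1r : 0 < 1 - r := by linarith
  have hL0 : 0 ≤ L := tsum_nonneg fun k => by
    have := hb (k + 1); positivity
  refine ⟨L, fun x hx => ?_⟩
  have hd : ‖deriv (Fb b) x‖ ≤ L := by
    refine norm_deriv_le_of_lip' hL0 ?_
    filter_upwards [Ioo_mem_nhds hx.1 hx.2] with y hy
    have e : Fb b y - Fb b x = -∑' k : ℕ, (b (k + 1) * Real.log (1 - y ^ (k + 1)) -
        b (k + 1) * Real.log (1 - x ^ (k + 1))) := by
      rw [(h1.summable_log hb hy.1 (hy.2.trans hr1)).tsum_sub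
        (h1.summable_log hb hx.1 (hx.2.trans hr1))]
      unfold Fb; ring
    rw [e, norm_neg]
    refine tsum_of_norm_bounded (hs.hasSum.mul_right ‖y - x‖) fun k => ?_
    rw [← mul_sub, norm_mul, Real.norm_of_nonneg (hb (k + 1))]
    have h3 := mul_le_mul_of_nonneg_left (log_term_lip hr1 hx hy k) (hb (k + 1))
    refine h3.trans (le_of_eq ?_)
    ring
  unfold Abf
  rw [abs_mul, abs_of_pos hx.1]
  rw [Real.norm_eq_abs] at hd
  have := hx.2
  nlinarith [abs_nonneg (deriv (Fb b) x)]

lemma alpha_small {b : ℕ → ℝ} (hb : ∀ k, 0 ≤ b k) {ρ C₀ A : ℝ} {Dc : ℂ → ℂ}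
    (h1 : M1 b ρ C₀ A Dc) {α : ℕ → ℝ}
    (hα : ∀ᶠ n : ℕ in atTop, 0 < α n ∧ Abf b (Real.exp (-α n)) = n) :
    Tendsto α atTop (𝓝[>] 0) := by
  rw [tendsto_nhdsWithin_iff]
  refine ⟨?_, hα.mono fun n h => h.1⟩
  rw [tendsto_order]
  refine ⟨fun a ha => hα.mono fun n h => ha.trans h.1, fun ε hε => ?_⟩
  obtain ⟨L, hL⟩ := h1.Abf_bound hb (r := Real.exp (-(ε / 2))) (Real.exp_pos _)
    (by rw [Real.exp_lt_one_iff]; linarith)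
  filter_upwards [hα, tendsto_natCast_atTop_atTop.eventually_gt_atTop L] with n h hn
  by_contra hc
  have h3 := hL (Real.exp (-α n)) ⟨Real.exp_pos _, Real.exp_lt_exp.2 (by linarith)⟩
  rw [h.2] at h3
  linarith [le_abs_self (n:ℝ)]

lemma infinite_abel {b : ℕ → ℝ} (hb : ∀ k, 0 ≤ b k) {ρ C₀ A κ C q D : ℝ} {Dc : ℂ → ℂ}
    (h1 : M1 b ρ C₀ A Dc)
    (hκρ : ρ - 1 ≤ κ) (hC : 0 ≤ C) (hq : 0 < q) (hD0 : 0 < D)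
    (hR : ∀ x : ℝ, 1 ≤ x → |∑ k ∈ Finset.Icc 0 ⌊x⌋₊, b k - A * x ^ ρ / ρ| ≤ C * x ^ κ)
    (hD : ∀ y : ℝ, 0 ≤ y → y ^ κ ≤ D * Real.exp ((1 - q) * y))
    {α : ℝ} (hα : 0 < α) {m : ℕ} (hm : 1 ≤ m) (hmα : 1 ≤ m * α) :
    |Fmb b m (Real.exp (-α)) - Fb b (Real.exp (-α)) - A * α ^ (-ρ) *
      ∫ y in Set.Ioi (((m:ℝ) + 1) * α), y ^ (ρ - 1) * Real.log (1 - Real.exp (-y))| ≤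
      (2 * C * (2 + 1 / q) + 2 * A) * D * α ^ (-κ) * Real.exp (-(q * α) * m) := by
  have hρ := h1.1
  have hA := h1.2.2.2.1
  have hm1 : (1:ℝ) ≤ m := by exact_mod_cast hm
  have hpow : ∀ k : ℕ, Real.exp (-α) ^ k = Real.exp (-((k:ℝ) * α)) := by
    intro k; rw [← Real.exp_nat_mul]; ring_nf
  have hsum : Tendsto (fun N : ℕ => ∑ k ∈ Finset.Ioc m N, gFn α k * b k) atTop
      (𝓝 (Fmb b m (Real.exp (-α)) - Fb b (Real.exp (-α)))) := by
    have hs := (h1.summable_log hb (Real.exp_pos (-α))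
      (by rw [Real.exp_lt_one_iff]; linarith)).hasSum.tendsto_sum_nat
    have h3 := hs.sub_const (∑ k ∈ Finset.Icc 1 m, b k * Real.log (1 - Real.exp (-α) ^ k))
    have e : Fmb b m (Real.exp (-α)) - Fb b (Real.exp (-α)) =
      (∑' k : ℕ, b (k + 1) * Real.log (1 - Real.exp (-α) ^ (k + 1))) -
      ∑ k ∈ Finset.Icc 1 m, b k * Real.log (1 - Real.exp (-α) ^ k) := by
      unfold Fmb Fb; ring
    rw [e]
    refine h3.congr' ?_
    filter_upwards [eventually_ge_atTop m] with N hN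
    have e2 : ∑ k ∈ Finset.range N, b (k + 1) * Real.log (1 - Real.exp (-α) ^ (k + 1)) =
        ∑ k ∈ Finset.Ioc 0 N, b k * Real.log (1 - Real.exp (-α) ^ k) := by
      rw [Finset.range_eq_Ico, Finset.sum_Ico_add' (fun k => b k * Real.log (1 - Real.exp (-α) ^ k))]
      apply Finset.sum_congr _ fun _ _ => rfl
      ext k; simp; omega
    have e3 : Finset.Icc 1 m = Finset.Ioc 0 m := by ext k; simp; omega
    rw [e2, e3, ← Finset.sum_Ioc_consecutive _ (Nat.zero_le m) hN, add_sub_cancel_left]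
    refine Finset.sum_congr rfl fun k _ => ?_
    rw [hpow, gFn, mul_comm]
  have hcont : ContinuousOn (fun x : ℝ => x ^ (ρ - 1) * gFn α x) (Set.Ioi ((m:ℝ) + 1)) := by
    intro x hx
    have hx0 : 0 < x := by have : (m:ℝ) + 1 < x := hx
                           linarith
    exact ((Real.continuousAt_rpow_const x _ (Or.inl hx0.ne')).mul
      (hasDerivAt_gFn hα hx0).continuousAt).continuousWithinAt
  have hqα : 0 < q * α := by positivity
  have hIntg : IntegrableOn (fun x : ℝ => x ^ (ρ - 1) * gFn α x) (Set.Ioi ((m:ℝ) + 1)) := by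
    have hg : IntegrableOn (fun x : ℝ => 2 * D * α ^ (-κ) * Real.exp (-(q * α) * x))
        (Set.Ioi ((m:ℝ) + 1)) :=
      (integrableOn_exp_mul_Ioi (by linarith) _).const_mul _
    refine Integrable.mono' hg (hcont.aestronglyMeasurable measurableSet_Ioi) ?_
    refine (ae_restrict_iff' measurableSet_Ioi).2 (Eventually.of_forall fun x hx => ?_)
    have hx1 : (m:ℝ) + 1 < x := hx
    have h3 : 1 ≤ x * α := hmα.trans (by gcongr; linarith)
    have h4 := abs_gFn_le h3
    have h5 := weight_le hα (by linarith : 0 ≤ x) hD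
    have h6 : x ^ (ρ - 1) ≤ x ^ κ := Real.rpow_le_rpow_of_exponent_le (by linarith) hκρ
    have h7 : 0 ≤ x ^ (ρ - 1) := Real.rpow_nonneg (by linarith) _
    have h8 : 0 ≤ x ^ κ := h7.trans h6
    rw [Real.norm_eq_abs, abs_mul, abs_of_nonneg h7]
    calc x ^ (ρ - 1) * |gFn α x| ≤ x ^ κ * (2 * Real.exp (-(x * α))) := by gcongr
      _ = 2 * (x ^ κ * Real.exp (-(x * α))) := by ring
      _ ≤ 2 * (D * α ^ (-κ) * Real.exp (-(q * α) * x)) := by gcongr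
      _ = _ := by ring
  have hlim := intervalIntegral_tendsto_integral_Ioi ((m:ℝ) + 1) hIntg
    (tendsto_natCast_atTop_atTop (R := ℝ))
  have hsub : A * α ^ (-ρ) *
      ∫ y in Set.Ioi (((m:ℝ) + 1) * α), y ^ (ρ - 1) * Real.log (1 - Real.exp (-y)) =
      A * ∫ x in Set.Ioi ((m:ℝ) + 1), x ^ (ρ - 1) * gFn α x := by
    have h3 := integral_comp_mul_right_Ioi
      (fun y : ℝ => y ^ (ρ - 1) * Real.log (1 - Real.exp (-y))) ((m:ℝ) + 1) hα
    have h4 : ∫ x in Set.Ioi ((m:ℝ) + 1), (x * α) ^ (ρ - 1) * Real.log (1 - Real.exp (-(x * α))) =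
        α ^ (ρ - 1) * ∫ x in Set.Ioi ((m:ℝ) + 1), x ^ (ρ - 1) * gFn α x := by
      rw [← integral_const_mul]
      refine setIntegral_congr_fun measurableSet_Ioi fun x hx => ?_
      have hx1 : (m:ℝ) + 1 < x := hx
      simp only [gFn]
      rw [Real.mul_rpow (by linarith) hα.le]; ring
    rw [h4, smul_eq_mul] at h3
    have h5 : α ^ (-ρ) = α⁻¹ * (α ^ (ρ - 1))⁻¹ := by
      rw [← Real.rpow_neg hα.le, ← Real.rpow_neg_one, ← Real.rpow_add hα]; ring_nf
    have h6 : α ^ (ρ - 1) ≠ 0 := (Real.rpow_pos_of_pos hα _).ne'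
    rw [h5]
    calc _ = A * (α ^ (ρ - 1))⁻¹ * (α⁻¹ *
        ∫ y in Set.Ioi (((m:ℝ) + 1) * α), y ^ (ρ - 1) * Real.log (1 - Real.exp (-y))) := by ring
      _ = _ := by rw [← h3]; field_simp
  rw [hsub]
  refine le_of_tendsto (hsum.sub (hlim.const_mul A)).abs ?_
  filter_upwards [eventually_ge_atTop (m + 1)] with N hN
  exact finite_abel hρ hA hκρ hC hq hD0 hR hD hα hm hmα hN

theorem statement18    (b : ℕ → ℝ) (hb : ∀ k, 0 ≤ b k) (ρ C₀ A C₁ : ℝ) (Dc : ℂ → ℂ)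
    (h1 : M1 b ρ C₀ A Dc) (h2 : M2 C₀ C₁ Dc)
    (α : ℕ → ℝ) (hα : ∀ᶠ n : ℕ in atTop, 0 < α n ∧ Abf b (Real.exp (-α n)) = n)
    (m : ℕ → ℕ)
    (hm : (fun n : ℕ => (m n : ℝ)) ~[atTop] fun n : ℕ => ρ * (α n)⁻¹ * Real.log (α n)⁻¹) :
    Tendsto (fun n : ℕ =>
        Fmb b (m n) (Real.exp (-α n)) - Fb b (Real.exp (-α n))
          - A * α n ^ (-ρ) *
            ∫ y in Set.Ioi (((m n : ℝ) + 1) * α n), y ^ (ρ - 1) * Real.log (1 - Real.exp (-y)))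
      atTop (𝓝 0) := by
  obtain ⟨κ, C, hκ0, hκ, hκρ, hC, hR⟩ := landau0 hb h1 h2
  have hρ := h1.1
  have hA := h1.2.2.2.1
  set k := κ / ρ with hk
  have hk0 : 0 ≤ k := by positivity
  have hk1 : k < 1 := by rw [hk, div_lt_one hρ]; exact hκ
  have hκk : κ = k * ρ := by rw [hk]; field_simp
  set q := (1 + k) / 2 with hqd
  have hq0 : 0 < q := by rw [hqd]; linarith
  have hq1 : q < 1 := by rw [hqd]; linarith
  have hqk : 0 < q ^ 2 * ρ - κ := by
    have : q ^ 2 * ρ - κ = ((1 - k) / 2) ^ 2 * ρ := by rw [hκk, hqd]; ring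
    rw [this]
    have : 0 < 1 - k := by linarith
    positivity
  obtain ⟨D, hD0, hD⟩ := rpow_le_exp_mul (κ := κ) (ε := 1 - q) hκ0 (by linarith)
  have hαt := alpha_small hb h1 hα
  have hα0 : Tendsto α atTop (𝓝 0) := (tendsto_nhdsWithin_iff.1 hαt).1
  have hlog : Tendsto (fun n => Real.log (α n)⁻¹) atTop atTop :=
    Real.tendsto_log_atTop.comp (tendsto_inv_nhdsGT_zero.comp hαt)
  have hpow : Tendsto (fun n => ((2 * C * (2 + 1 / q) + 2 * A) * D) * α n ^ (q ^ 2 * ρ - κ))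
      atTop (𝓝 0) := by
    have h3 := hα0.rpow_const (p := q ^ 2 * ρ - κ) (Or.inr hqk.le)
    rw [Real.zero_rpow hqk.ne'] at h3
    simpa using h3.const_mul ((2 * C * (2 + 1 / q) + 2 * A) * D)
  refine squeeze_zero_norm' ?_ hpow
  have hlo := hm.isLittleO.def (c := 1 - q) (by linarith)
  filter_upwards [hα, hlo, hlog.eventually_ge_atTop (1 / (q * ρ)), hlog.eventually_gt_atTop 0]
    with n h3 h4 h5 h6
  have hαn := h3.1
  set L := Real.log (α n)⁻¹ with hL
  have hmn : q * (ρ * (α n)⁻¹ * L) ≤ m n := by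
    have h7 : 0 ≤ ρ * (α n)⁻¹ * L := by positivity
    simp only [Pi.sub_apply, Real.norm_eq_abs] at h4
    rw [abs_of_nonneg h7] at h4
    have := (abs_le.1 h4).1
    linarith
  have hmα : q * ρ * L ≤ m n * α n := by
    have := mul_le_mul_of_nonneg_right hmn hαn.le
    refine le_trans (le_of_eq ?_) this
    field_simp
  have hmα1 : 1 ≤ m n * α n := by
    refine le_trans ?_ hmα
    rw [div_le_iff₀ (by positivity)] at h5
    linarith
  have hm1 : 1 ≤ m n := by
    by_contra hc
    have : m n = 0 := by omega
    rw [this] at hmα1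
    norm_num at hmα1
  refine (infinite_abel hb h1 hκρ hC hq0 hD0 hR hD hαn hm1 hmα1).trans ?_
  have h8 : Real.exp (-(q * α n) * m n) ≤ α n ^ (q ^ 2 * ρ) := by
    rw [Real.rpow_def_of_pos hαn]
    apply Real.exp_le_exp.2
    have h9 : Real.log (α n) = -L := by rw [hL, Real.log_inv]; ring
    rw [h9]
    nlinarith
  have h10 : 0 ≤ (2 * C * (2 + 1 / q) + 2 * A) * D * α n ^ (-κ) := by positivity
  refine (mul_le_mul_of_nonneg_left h8 h10).trans (le_of_eq ?_)
  rw [sub_eq_add_neg, Real.rpow_add hαn]; ring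
end
end
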